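/- arXiv:2301.13084 — 3 statements merged into one kernel-verified Lean document; each statement's English description precedes it below -/
import Mathlib

section
/- Let (R,m) be a Noetherian local ring of dimension d and let Q = (x₁,…,x_d) be a parameter ideal. For n ≥ 0 set Λ_{n+1} = {α = (α₁,…,α_d) ∈ ℕ^d : each α_i ≥ 1 and Σ α_i = n+1}, and for α ∈ Λ_{n+1} set Q(α) = (x₁^{α₁},…,x_d^{α_d}). Then ℓ(R / ⋂_{α ∈ Λ_{n+1}} Q(α)^{lim}) ≤ binom(n+d,d)·e(Q,R), where e(Q,R) is the Hilbert–Samuel multiplicity of Q. -/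
open IsLocalRing

universe u

section BasicDefs

variable (R : Type*) [CommRing R]

/-- The length of a module, i.e. the Krull dimension of its lattice of submodules. -/
noncomputable def moduleLength (M : Type*) [AddCommGroup M] [Module R M] : WithBot ℕ∞ :=
  Order.krullDim (Submodule R M)

/-- A system of parameters of a Noetherian local ring: `d` elements generating an
ideal whose radical is the maximal ideal, where `d` is the Krull dimension. -/
def IsSOP [IsLocalRing R] {d : ℕ} (x : Fin d → R) : Prop :=
  ringKrullDim R = (d : WithBot ℕ∞) ∧
    (Ideal.span (Set.range x)).radical = maximalIdeal R

/-- A parameter ideal is an ideal generated by a system of parameters. -/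
def IsParameterIdeal [IsLocalRing R] (Q : Ideal R) : Prop :=
  ∃ (d : ℕ) (x : Fin d → R), IsSOP R x ∧ Q = Ideal.span (Set.range x)

/-- `f : R →+* B` makes `B` a balanced big Cohen-Macaulay `R`-algebra if every system of
parameters of `R` maps to a regular sequence on `B` and `m·B ≠ B`. -/
def IsBalancedBigCMHom [IsLocalRing R] {B : Type*} [CommRing B] (f : R →+* B) : Prop :=
  (∀ (d : ℕ) (x : Fin d → R), IsSOP R x →
      RingTheory.Sequence.IsRegular B (List.ofFn fun i => f (x i))) ∧
    (maximalIdeal R).map f ≠ ⊤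

/-- A balanced big Cohen-Macaulay algebra. -/
def IsBalancedBigCM [IsLocalRing R] (B : Type*) [CommRing B] [Algebra R B] : Prop :=
  IsBalancedBigCMHom R (algebraMap R B)

/-- The integral closure of an ideal `I`, as a set: all `x` satisfying an equation
`x^n + a₁ x^{n-1} + ⋯ + aₙ = 0` with `aₖ ∈ I^k`. -/
def intClSet (I : Ideal R) : Set R :=
  { x | ∃ n : ℕ, 0 < n ∧ ∃ a : ℕ → R,
      (∀ k ∈ Finset.Icc 1 n, a k ∈ I ^ k) ∧
      x ^ n + ∑ k ∈ Finset.Icc 1 n, a k * x ^ (n - k) = 0 }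

/-- `I^B := IB ∩ R`, the contraction of the extension of `I` along `f : R →+* B`. -/
def contractedExt {B : Type*} [CommRing B] (f : R →+* B) (I : Ideal R) : Ideal R :=
  (I.map f).comap f

/-- Condition (†): `I^B ⊆ \bar I` for every m-primary ideal `I`. -/
def SatisfiesDagger [IsLocalRing R] {B : Type*} [CommRing B] (f : R →+* B) : Prop :=
  ∀ I : Ideal R, I.radical = maximalIdeal R →
    (contractedExt R f I : Set R) ⊆ intClSet R I

/-- `e` is the family of Hilbert coefficients of the filtration `J` (in dimension `d`):
for `n ≫ 0`, `ℓ(R/J (n+1)) = ∑_{i≤d} (-1)^i e i * choose (n+d-i) (d-i)`. -/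
def HasHilbertSeries (d : ℕ) (J : ℕ → Ideal R) (e : ℕ → ℤ) : Prop :=
  ∃ N : ℕ, ∀ n ≥ N, ∃ m : ℕ,
    moduleLength R (R ⧸ J (n + 1)) = (m : WithBot ℕ∞) ∧
    (m : ℤ) = ∑ i ∈ Finset.range (d + 1),
      (-1) ^ i * e i * ((n + d - i).choose (d - i) : ℤ)

/-- Module version of `HasHilbertSeries`, for the `J`-adic filtration of a module `M`. -/
def HasHilbertSeriesMod (M : Type*) [AddCommGroup M] [Module R M] (d : ℕ)
    (J : Ideal R) (e : ℕ → ℤ) : Prop :=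
  ∃ N : ℕ, ∀ n ≥ N, ∃ m : ℕ,
    moduleLength R (M ⧸ (J ^ (n + 1) • (⊤ : Submodule R M))) = (m : WithBot ℕ∞) ∧
    (m : ℤ) = ∑ i ∈ Finset.range (d + 1),
      (-1) ^ i * e i * ((n + d - i).choose (d - i) : ℤ)


/-- The limit closure `(x₁,…,x_d)^{lim} = ⋃ₜ ((x₁^{t+1},…,x_d^{t+1}) : (x₁⋯x_d)^t)`. -/
def limitClosure {d : ℕ} (x : Fin d → R) : Ideal R :=
  ⨆ t : ℕ, (Ideal.span (Set.range fun i => x i ^ (t + 1))).colon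
    (Ideal.span {(∏ i, x i) ^ t})

/-- A ring is equidimensional if `dim (R/P) = dim R` for every minimal prime `P`. -/
def IsEquidimensional : Prop :=
  ∀ P ∈ minimalPrimes R, ringKrullDim (R ⧸ P) = ringKrullDim R

/-- Depth at least `n`: there is a regular sequence of length `n` in the
(Jacobson) radical, i.e. in the maximal ideal when `R` is local. -/
def HasDepthGE (n : ℕ) : Prop :=
  ∃ rs : List R, rs.length = n ∧ (∀ r ∈ rs, r ∈ (⊥ : Ideal R).jacobson) ∧
    RingTheory.Sequence.IsRegular R rs

/-- A Cohen-Macaulay (Noetherian) local ring: depth = dimension. -/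
def IsCohenMacaulayLocalRing : Prop :=
  IsLocalRing R ∧ IsNoetherianRing R ∧
    ∃ d : ℕ, ringKrullDim R = (d : WithBot ℕ∞) ∧ HasDepthGE R d

/-- Serre's condition S₂: for every prime `P`,
`depth R_P ≥ min 2 (dim R_P)`. -/
def SerreS2 : Prop :=
  ∀ (P : Ideal R) (hP : P.IsPrime) (n : ℕ),
    (n : WithBot ℕ∞) ≤ min 2 (ringKrullDim (Localization.AtPrime P)) →
    HasDepthGE (Localization.AtPrime P) n

/-- A regular local ring: a Noetherian local ring whose maximal ideal is generated
by `dim R` elements. -/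
def IsRegularLocal : Prop :=
  IsLocalRing R ∧ IsNoetherianRing R ∧ ∃ (d : ℕ) (x : Fin d → R),
    ringKrullDim R = (d : WithBot ℕ∞) ∧
      Ideal.span (Set.range x) = (⊥ : Ideal R).jacobson

/-- A regular (not necessarily local) ring: Noetherian and all localizations at
primes are regular local rings. -/
def IsRegularRing' : Prop :=
  IsNoetherianRing R ∧
    ∀ (P : Ideal R) (hP : P.IsPrime), IsRegularLocal (Localization.AtPrime P)

/-- The tight closure of an ideal `I` in characteristic `p`, as a set. -/
def tightClSet (p : ℕ) (I : Ideal R) : Set R :=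
  { x | ∃ c : R, (∀ P ∈ minimalPrimes R, c ∉ P) ∧
      ∃ E : ℕ, ∀ e ≥ E, c * x ^ p ^ e ∈ Ideal.span ((fun a => a ^ p ^ e) '' (I : Set R)) }

/-- F-rationality: every parameter ideal is tightly closed. -/
def IsFRational [IsLocalRing R] (p : ℕ) : Prop :=
  ∀ Q : Ideal R, IsParameterIdeal R Q → tightClSet R p Q ⊆ (Q : Set R)

end BasicDefs

section Excellence

open TensorProduct

/-- Geometrically regular `k`-algebra (for `k` a field): `L ⊗[k] A` is regular
for every finite field extension `L` of `k`. -/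
def IsGeometricallyRegular (k : Type u) (A : Type u) [CommRing k] [CommRing A]
    [Algebra k A] : Prop :=
  ∀ (L : Type u) [Field L] [Algebra k L], Module.Finite k L → IsRegularRing' (L ⊗[k] A)

/-- `R` is a G-ring: for every prime `p`, the fibers of
`R_p → (R_p)^∧` are geometrically regular. -/
def IsGRing (R : Type u) [CommRing R] : Prop :=
  ∀ (p : Ideal R) (hp : p.IsPrime) (q : Ideal (Localization.AtPrime p)) (hq : q.IsPrime),
    IsGeometricallyRegular
      (ResidueField (Localization.AtPrime q))
      ((ResidueField (Localization.AtPrime q))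
        ⊗[Localization.AtPrime p]
        AdicCompletion (maximalIdeal (Localization.AtPrime p)) (Localization.AtPrime p))

/-- `R` is J-2: the regular locus of every finitely generated `R`-algebra is open. -/
def IsJ2 (R : Type u) [CommRing R] : Prop :=
  ∀ (A : Type u) [CommRing A] [Algebra R A], Algebra.FiniteType R A →
    IsOpen { P : PrimeSpectrum A | IsRegularLocal (Localization.AtPrime P.asIdeal) }

/-- A catenary ring: any two saturated chains of primes with the same endpoints
have the same length. -/
def IsCatenary (A : Type*) [CommRing A] : Prop :=
  ∀ c₁ c₂ : LTSeries (PrimeSpectrum A),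
    c₁.head = c₂.head → c₁.last = c₂.last →
    (∀ i : Fin c₁.length, c₁.toFun i.castSucc ⋖ c₁.toFun i.succ) →
    (∀ i : Fin c₂.length, c₂.toFun i.castSucc ⋖ c₂.toFun i.succ) →
    c₁.length = c₂.length

/-- Universally catenary: every finitely generated `R`-algebra is catenary. -/
def IsUniversallyCatenary (R : Type u) [CommRing R] : Prop :=
  ∀ (A : Type u) [CommRing A] [Algebra R A], Algebra.FiniteType R A → IsCatenary A

/-- An excellent ring: Noetherian, a G-ring, J-2 and universally catenary. -/
def IsExcellentRing (R : Type u) [CommRing R] : Prop :=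
  IsNoetherianRing R ∧ IsGRing R ∧ IsJ2 R ∧ IsUniversallyCatenary R

end Excellence

/-- `R` is BCM_B-rational (in dimension `d`): Cohen-Macaulay and the natural map
`H^d_m(R) → H^d_m(B)` is injective. -/
def IsBCMRational (R : Type u) [CommRing R] [IsLocalRing R]
    (B : Type u) [CommRing B] [Algebra R B] (d : ℕ) : Prop :=
  IsCohenMacaulayLocalRing R ∧
    Function.Injective
      ((localCohomology (maximalIdeal R) d).map (ModuleCat.ofHom (Algebra.linearMap R B)))

namespace LimClos

open Finset

variable {R : Type u} [CommRing R]

/-- Length of `R ⧸ I`. -/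
noncomputable def len (I : Ideal R) : ℕ∞ := Module.length R (R ⧸ I)

/-- The colon ideal `I : y`. -/
def col (I : Ideal R) (y : R) : Ideal R := Submodule.comap (LinearMap.mulLeft R y) I

theorem mem_col {I : Ideal R} {y r : R} : r ∈ col I y ↔ y * r ∈ I := Iff.rfl

theorem len_anti {I J : Ideal R} (h : I ≤ J) : len J ≤ len I := by
  unfold len
  exact Module.length_le_of_surjective (Submodule.factor h) (Submodule.factor_surjective h)

theorem len_top : len (⊤ : Ideal R) = 0 := by
  unfold len
  have : Subsingleton (R ⧸ (⊤ : Ideal R)) := Ideal.Quotient.subsingleton_iff.mpr rfl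
  exact Module.length_eq_zero

theorem len_col (I : Ideal R) (y : R) :
    len I = len (col I y) + len (I ⊔ Ideal.span {y}) := by
  unfold len
  have hle : I ≤ I ⊔ Ideal.span {y} := le_sup_left
  refine Module.length_eq_add_of_exact
    (Submodule.mapQ (col I y) I (LinearMap.mulLeft R y) le_rfl)
    (Submodule.factor hle) ?_ (Submodule.factor_surjective hle) ?_
  · rw [injective_iff_map_eq_zero]
    intro w hw
    obtain ⟨c, rfl⟩ := Submodule.mkQ_surjective _ w
    have h1 : (Submodule.Quotient.mk (y * c) : R ⧸ I) = 0 := hw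
    have h2 : c ∈ col I y := mem_col.mpr ((Submodule.Quotient.mk_eq_zero _).mp h1)
    exact (Submodule.Quotient.mk_eq_zero _).mpr h2
  · intro z
    obtain ⟨r, rfl⟩ := Submodule.mkQ_surjective _ z
    constructor
    · intro h
      have h1 : r ∈ I ⊔ Ideal.span {y} := by
        have : (Submodule.Quotient.mk r : R ⧸ (I ⊔ Ideal.span {y})) = 0 := h
        exact (Submodule.Quotient.mk_eq_zero _).mp this
      obtain ⟨a, ha, b, hb, rfl⟩ := Submodule.mem_sup.mp h1
      obtain ⟨c, rfl⟩ := Ideal.mem_span_singleton.mp hb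
      refine ⟨Submodule.Quotient.mk c, ?_⟩
      change (Submodule.Quotient.mk (y * c) : R ⧸ I) = Submodule.Quotient.mk (a + y * c)
      rw [Submodule.Quotient.eq]
      simpa using ha
    · rintro ⟨w, hw⟩
      obtain ⟨c, rfl⟩ := Submodule.mkQ_surjective _ w
      rw [← hw]
      change (Submodule.Quotient.mk (y * c) : R ⧸ (I ⊔ Ideal.span {y})) = 0
      rw [Submodule.Quotient.mk_eq_zero]
      exact Ideal.mem_sup_right (Ideal.mul_mem_right _ _ (Ideal.mem_span_singleton_self y))

theorem len_col_pow (I : Ideal R) (y : R) (a : ℕ) :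
    len I = (∑ s ∈ range a, len (col I (y ^ s) ⊔ Ideal.span {y})) + len (col I (y ^ a)) := by
  induction a with
  | zero =>
    have : col I (y ^ 0) = I := by ext r; simp [mem_col]
    rw [this]; simp
  | succ a ih =>
    have h2 : col (col I (y ^ a)) y = col I (y ^ (a + 1)) := by
      ext r; simp only [mem_col]; rw [pow_succ, mul_assoc]
    rw [ih, sum_range_succ, len_col (col I (y ^ a)) y, h2]
    ring

theorem pow_le_of_pow_mem {ι : Type*} [Fintype ι] [DecidableEq ι] (x : ι → R) (K : ℕ) :
    ∀ (I : Ideal R) (p : ι → ℕ), ∑ i, p i < K → (∀ i, x i ^ p i ∈ I) →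
      Ideal.span (Set.range x) ^ K ≤ I := by
  induction K with
  | zero => intro I p h; omega
  | succ K ih =>
    intro I p hK hI
    rw [pow_succ', Ideal.mul_le]
    intro r hr s hs
    induction hr using Submodule.span_induction with
    | zero => simp
    | add a b _ _ ha hb => rw [add_mul]; exact I.add_mem ha hb
    | smul c a _ ha => rw [smul_eq_mul, mul_assoc]; exact I.mul_mem_left _ ha
    | mem a ha =>
      obtain ⟨i, rfl⟩ := ha
      rcases Nat.eq_zero_or_pos (p i) with h0 | hpos
      · have := hI i
        rw [h0, pow_zero] at this
        rw [(Ideal.eq_top_iff_one I).mpr this]; trivial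
      · refine ih (col I (x i)) (Function.update p i (p i - 1)) ?_ ?_ hs
        · rw [sum_update_of_mem (mem_univ i)]
          rw [← sum_erase_add _ _ (mem_univ i)] at hK
          have : univ \ {i} = univ.erase i := by ext; simp
          rw [this]; omega
        · intro j
          rw [mem_col]
          by_cases hj : j = i
          · subst hj
            rw [Function.update_self, ← pow_succ', Nat.sub_add_cancel hpos]
            exact hI j
          · rw [Function.update_of_ne hj]
            exact I.mul_mem_left _ (hI j)

section L

variable {d : ℕ} (x : Fin d → R)

theorem span_mul_prod_mem (p k : Fin d → ℕ) (y : R)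
    (hy : y ∈ Ideal.span (Set.range fun i => x i ^ p i)) :
    y * ∏ i, x i ^ k i ∈ Ideal.span (Set.range fun i => x i ^ (p i + k i)) := by
  induction hy using Submodule.span_induction with
  | zero => simp
  | add a b _ _ ha hb => rw [add_mul]; exact Ideal.add_mem _ ha hb
  | smul c a _ ha => rw [smul_eq_mul, mul_assoc]; exact Ideal.mul_mem_left _ _ ha
  | mem a ha =>
    obtain ⟨i, rfl⟩ := ha
    change x i ^ p i * ∏ i, x i ^ k i ∈ _
    rw [← mul_prod_erase univ _ (mem_univ i), ← mul_assoc, ← pow_add]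
    exact Ideal.mul_mem_right _ _ (Ideal.subset_span ⟨i, rfl⟩)

/-- Membership at level `M`. -/
def Lev (α : Fin d → ℕ) (M : ℕ) (r : R) : Prop :=
  (∀ i, α i ≤ M) ∧ r * ∏ i, x i ^ (M - α i) ∈ Ideal.span (Set.range fun i => x i ^ M)

theorem Lev.mono {α : Fin d → ℕ} {M M' : ℕ} {r : R} (h : Lev x α M r) (hM : M ≤ M') :
    Lev x α M' r := by
  refine ⟨fun i => (h.1 i).trans hM, ?_⟩
  have := span_mul_prod_mem x (fun _ => M) (fun _ => M' - M) _ h.2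
  rw [mul_assoc, ← prod_mul_distrib] at this
  simp only [← pow_add] at this
  have e1 : ∀ i, M - α i + (M' - M) = M' - α i := fun i => by have := h.1 i; omega
  have e2 : M + (M' - M) = M' := by omega
  simp only [e1, e2] at this
  exact this

/-- Annihilator of the class `1 / x^α` in top local cohomology. -/
def L (α : Fin d → ℕ) : Ideal R where
  carrier := {r | ∃ M, Lev x α M r}
  zero_mem' := by
    obtain ⟨M, hM⟩ : ∃ M, ∀ i, α i ≤ M := ⟨univ.sup α, fun i => le_sup (mem_univ i)⟩
    exact ⟨M, hM, by simp⟩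
  add_mem' := by
    rintro a b ⟨M, hM⟩ ⟨M', hM'⟩
    refine ⟨max M M', (hM.mono x (le_max_left _ _)).1, ?_⟩
    rw [add_mul]
    exact Ideal.add_mem _ (hM.mono x (le_max_left _ _)).2 (hM'.mono x (le_max_right _ _)).2
  smul_mem' := by
    rintro c r ⟨M, h1, h2⟩
    exact ⟨M, h1, by rw [smul_eq_mul, mul_assoc]; exact Ideal.mul_mem_left _ _ h2⟩

theorem mem_L {α : Fin d → ℕ} {r : R} : r ∈ L x α ↔ ∃ M, Lev x α M r := Iff.rfl

theorem L_anti {α β : Fin d → ℕ} (h : α ≤ β) : L x β ≤ L x α := by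
  rintro r ⟨M, h1, h2⟩
  refine ⟨M, fun i => (h i).trans (h1 i), ?_⟩
  have : ∏ i, x i ^ (M - α i) = (∏ i, x i ^ (M - β i)) * ∏ i, x i ^ (β i - α i) := by
    rw [← prod_mul_distrib]
    refine prod_congr rfl fun i _ => ?_
    rw [← pow_add]
    congr 1
    have h3 : α i ≤ β i := h i
    have := h1 i; omega
  rw [this, ← mul_assoc]
  exact Ideal.mul_mem_right _ _ h2

/-- `(∏ x^γ) r ∈ L (α + γ) ↔ r ∈ L α`. -/
theorem prod_mul_mem_L {α γ : Fin d → ℕ} {r : R} :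
    (∏ i, x i ^ γ i) * r ∈ L x (fun i => α i + γ i) ↔ r ∈ L x α := by
  have key : ∀ M, (∀ i, α i + γ i ≤ M) →
      (∏ i, x i ^ γ i) * r * ∏ i, x i ^ (M - (α i + γ i)) = r * ∏ i, x i ^ (M - α i) := by
    intro M hM
    rw [mul_comm _ r, mul_assoc, ← prod_mul_distrib]
    congr 1
    refine prod_congr rfl fun i _ => ?_
    rw [← pow_add]; congr 1; have := hM i; omega
  constructor
  · rintro ⟨M, h1, h2⟩
    rw [key M h1] at h2
    exact ⟨M, fun i => by have := h1 i; simp only at this; omega, h2⟩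
  · rintro ⟨M, h⟩
    obtain ⟨M', hM'⟩ : ∃ M, ∀ i, α i + γ i ≤ M :=
      ⟨univ.sup fun i => α i + γ i, fun i => le_sup (f := fun i => α i + γ i) (mem_univ i)⟩
    have h' := h.mono x (le_max_left M M')
    have h3 : ∀ i, α i + γ i ≤ max M M' := fun i => (hM' i).trans (le_max_right _ _)
    refine ⟨max M M', h3, ?_⟩
    rw [key _ h3]
    exact h'.2

theorem pow_mul_mem_L {α : Fin d → ℕ} {i : Fin d} {s : ℕ} (hs : s ≤ α i) {r : R} :
    x i ^ s * r ∈ L x α ↔ r ∈ L x (Function.update α i (α i - s)) := by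
  rw [← prod_mul_mem_L x (α := Function.update α i (α i - s)) (γ := Pi.single i s)]
  have h1 : ∏ j, x j ^ (Pi.single i s : Fin d → ℕ) j = x i ^ s := by
    rw [prod_eq_single i]
    · simp
    · intro j _ hj; simp [hj]
    · simp
  have h2 : (fun j => Function.update α i (α i - s) j + (Pi.single i s : Fin d → ℕ) j) = α := by
    funext j
    by_cases hj : j = i
    · subst hj; simp [hs]
    · simp [hj]
  rw [h1, h2]

theorem pow_mem_L {α : Fin d → ℕ} {i : Fin d} {s : ℕ} (hs : α i ≤ s) : x i ^ s ∈ L x α := by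
  obtain ⟨M, hM⟩ : ∃ M, ∀ i, α i ≤ M := ⟨univ.sup α, fun i => le_sup (mem_univ i)⟩
  refine ⟨M, hM, ?_⟩
  rw [← mul_prod_erase univ _ (mem_univ i), ← mul_assoc, ← pow_add]
  refine Ideal.mul_mem_right _ _ ?_
  have : s + (M - α i) = M + (s - α i) := by have := hM i; omega
  rw [this, pow_add]
  exact Ideal.mul_mem_right _ _ (Ideal.subset_span ⟨i, rfl⟩)

theorem L_le_limitClosure {α : Fin d → ℕ} (hα : ∀ i, 1 ≤ α i) :
    L x α ≤ limitClosure R fun i => x i ^ α i := by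
  rintro r ⟨M, h1, h2⟩
  unfold limitClosure
  refine Submodule.mem_iSup_of_mem M ?_
  rw [Submodule.mem_colon]
  intro s hs
  obtain ⟨c, rfl⟩ := Ideal.mem_span_singleton.mp hs
  have h3 := span_mul_prod_mem x (fun _ => M) (fun i => α i * M - (M - α i)) _ h2
  rw [mul_assoc, ← prod_mul_distrib] at h3
  have hge : ∀ i, M ≤ α i * M := fun i => Nat.le_mul_of_pos_left _ (hα i)
  have e1 : ∏ i, x i ^ (M - α i) * x i ^ (α i * M - (M - α i)) = (∏ i, x i ^ α i) ^ M := by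
    rw [← prod_pow]
    refine prod_congr rfl fun i _ => ?_
    rw [← pow_add, ← pow_mul]; congr 1; have := hge i; omega
  have e2 : (fun i => x i ^ (M + (α i * M - (M - α i)))) = fun i => (x i ^ α i) ^ (M + 1) := by
    funext i
    rw [← pow_mul]; congr 1; have := hge i; have := h1 i; rw [mul_add]; omega
  rw [e1, e2] at h3
  rw [smul_eq_mul, ← mul_assoc]
  exact Ideal.mul_mem_right _ _ h3

/-- Intersection of the `L α`. -/
def J (S : Set (Fin d → ℕ)) : Ideal R := ⨅ α ∈ S, L x α

theorem mem_J {S : Set (Fin d → ℕ)} {r : R} : r ∈ J x S ↔ ∀ α ∈ S, r ∈ L x α := by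
  simp [J, Submodule.mem_iInf]

theorem step (S : Set (Fin d → ℕ)) (i : Fin d) (a N : ℕ) (hS : ∀ α ∈ S, α i ≤ a) :
    ((N - a : ℕ) : ℕ∞) * len (J x S) ≤
      ∑ s ∈ range a, len (J x ((fun α => Function.update α i N) '' {α ∈ S | s < α i})) := by
  set T : ℕ → ℕ → Set (Fin d → ℕ) :=
    fun s b => (fun α => Function.update α i b) '' {α ∈ S | s < α i} with hT
  have hup : len (J x S) ≤ ∑ s ∈ range a, len (J x (T s a) ⊔ Ideal.span {x i}) := by
    rw [len_col_pow (J x S) (x i) a]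
    have htop : col (J x S) (x i ^ a) = ⊤ := by
      rw [Ideal.eq_top_iff_one, mem_col, mul_one, mem_J]
      exact fun α hα => pow_mem_L x (hS α hα)
    rw [htop, len_top, add_zero]
    refine sum_le_sum fun s _ => len_anti (sup_le_sup_right ?_ _)
    intro r hr
    rw [mem_col, mem_J]
    intro α hα
    rcases le_or_gt (α i) s with h | h
    · exact Ideal.mul_mem_right _ _ (pow_mem_L x h)
    · rw [pow_mul_mem_L x h.le]
      have := (mem_J x).mp hr _ ⟨α, ⟨hα, h⟩, rfl⟩
      refine L_anti x ?_ this
      intro j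
      by_cases hj : j = i
      · subst hj; simp; have := hS α hα; omega
      · simp [hj]
  have hlow : ∀ s, ((N - a : ℕ) : ℕ∞) * len (J x (T s a) ⊔ Ideal.span {x i}) ≤
      len (J x (T s N)) := by
    intro s
    rw [len_col_pow (J x (T s N)) (x i) (N - a)]
    refine le_trans ?_ le_self_add
    rw [← nsmul_eq_mul]
    conv_lhs => rw [← card_range (N - a)]
    refine card_nsmul_le_sum _ _ _ fun t ht => len_anti (sup_le_sup_right ?_ _)
    rw [mem_range] at ht
    intro r hr
    rw [mem_col, mem_J] at hr
    rw [mem_J]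
    rintro _ ⟨α, hα, rfl⟩
    have h1 := hr _ ⟨α, hα, rfl⟩
    rw [pow_mul_mem_L x (by simp; omega)] at h1
    refine L_anti x ?_ h1
    intro j
    by_cases hj : j = i
    · subst hj; simp; omega
    · simp [hj]
  calc _ ≤ ((N - a : ℕ) : ℕ∞) * ∑ s ∈ range a, len (J x (T s a) ⊔ Ideal.span {x i}) := by gcongr
    _ = ∑ s ∈ range a, ((N - a : ℕ) : ℕ∞) * len (J x (T s a) ⊔ Ideal.span {x i}) := mul_sum _ _ _
    _ ≤ _ := sum_le_sum fun s _ => hlow s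

/-- Superadditivity over translated boxes. -/
theorem box_le (N : ℕ) (E : Finset (Fin d → ℕ)) : ∀ I : Ideal R,
    (∀ β ∈ E, I ≤ L x (fun i => N + N * β i)) →
    (E.card : ℕ∞) * len (L x fun _ => N) ≤ len I := by
  induction E using Finset.strongInduction with
  | H E ih =>
    intro I hI
    rcases E.eq_empty_or_nonempty with rfl | hne
    · simp
    obtain ⟨β, hβ⟩ := E.exists_maximal hne
    have hβE : β ∈ E := hβ.1
    set y := ∏ i, x i ^ (N * β i) with hy
    have h1 := ih (E.erase β) (erase_ssubset hβE) (I ⊔ Ideal.span {y}) (by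
      intro γ hγ
      rw [mem_erase] at hγ
      refine sup_le (hI γ hγ.2) ?_
      rw [Ideal.span_singleton_le_iff_mem]
      have : ¬ β ≤ γ := fun h => hγ.1 (le_antisymm (hβ.2 hγ.2 h) h)
      rw [Pi.le_def] at this
      push Not at this
      obtain ⟨i, hi⟩ := this
      rw [hy, ← mul_prod_erase univ _ (mem_univ i)]
      refine Ideal.mul_mem_right _ _ (pow_mem_L x ?_)
      nlinarith)
    have h2 : len (L x fun _ => N) ≤ len (col I y) := by
      refine len_anti fun r hr => ?_
      rw [mem_col] at hr
      exact (prod_mul_mem_L x (α := fun _ => N) (γ := fun i => N * β i)).mp (hI β hβE hr)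
    rw [len_col I y]
    rw [← card_erase_add_one hβE]
    push_cast
    rw [add_mul, one_mul, add_comm]
    exact add_le_add h2 h1

end L

theorem sum_update {d a : ℕ} (i : Fin d) (h : (Fin d → Fin a) → ℕ∞) :
    ∑ σ : Fin d → Fin a, ∑ s : Fin a, h (Function.update σ i s) = (a : ℕ∞) * ∑ σ, h σ := by
  have e : ∑ p : (Fin d → Fin a) × Fin a, h (Function.update p.1 i p.2) =
      ∑ p : (Fin d → Fin a) × Fin a, h p.1 := by
    refine Finset.sum_nbij' (fun p => (Function.update p.1 i p.2, p.1 i))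
      (fun p => (Function.update p.1 i p.2, p.1 i)) ?_ ?_ ?_ ?_ ?_ <;> simp
  rw [Fintype.sum_prod_type, Fintype.sum_prod_type] at e
  rw [e, mul_sum]
  refine sum_congr rfl fun σ _ => ?_
  simp

section Iter

variable {d : ℕ} (x : Fin d → R)

/-- Intermediate index sets. -/
def T (S : Set (Fin d → ℕ)) (N : ℕ) {a : ℕ} (D : Finset (Fin d)) (σ : Fin d → Fin a) :
    Set (Fin d → ℕ) :=
  (fun α i => if i ∈ D then N else α i) '' {α ∈ S | ∀ i ∈ D, (σ i : ℕ) < α i}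

theorem T_insert (S : Set (Fin d → ℕ)) (N : ℕ) {a : ℕ} (D : Finset (Fin d)) (σ : Fin d → Fin a)
    (i : Fin d) (hi : i ∉ D) (s : Fin a) :
    (fun α => Function.update α i N) '' {α ∈ T S N D σ | (s : ℕ) < α i} =
      T S N (insert i D) (Function.update σ i s) := by
  have hfun : ∀ α : Fin d → ℕ, Function.update (fun j => if j ∈ D then N else α j) i N =
      fun j => if j ∈ insert i D then N else α j := by
    intro α; funext j
    by_cases hj : j = i
    · subst hj; simp
    · simp [hj]
  have hc : ∀ α : Fin d → ℕ, (∀ j ∈ insert i D, ((Function.update σ i s) j : ℕ) < α j) ↔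
      (∀ j ∈ D, (σ j : ℕ) < α j) ∧ (s : ℕ) < α i := by
    intro α
    rw [forall_mem_insert]
    have : ∀ j ∈ D, (Function.update σ i s) j = σ j := by
      intro j hj
      exact Function.update_of_ne (by rintro rfl; exact hi hj) _ _
    constructor
    · rintro ⟨h1, h2⟩
      refine ⟨fun j hj => ?_, by simpa using h1⟩
      have := h2 j hj
      rwa [‹∀ j ∈ D, (Function.update σ i s) j = σ j› j hj] at this
    · rintro ⟨h1, h2⟩
      refine ⟨by simpa using h2, fun j hj => ?_⟩
      rw [this j hj]; exact h1 j hj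
  ext β
  constructor
  · rintro ⟨_, ⟨⟨α, ⟨hα, h1⟩, rfl⟩, h2⟩, rfl⟩
    refine ⟨α, ⟨hα, (hc α).mpr ⟨h1, ?_⟩⟩, (hfun α).symm⟩
    simpa [hi] using h2
  · rintro ⟨α, ⟨hα, h1⟩, rfl⟩
    obtain ⟨h1, h2⟩ := (hc α).mp h1
    refine ⟨_, ⟨⟨α, ⟨hα, h1⟩, rfl⟩, ?_⟩, hfun α⟩
    simpa [hi] using h2

theorem iter (S : Set (Fin d → ℕ)) (a N : ℕ) (hS : ∀ α ∈ S, ∀ i, α i ≤ a) (D : Finset (Fin d)) :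
    ((N - a : ℕ) : ℕ∞) ^ D.card * ((a : ℕ∞) ^ d * len (J x S)) ≤
      (a : ℕ∞) ^ D.card * ∑ σ : Fin d → Fin a, len (J x (T S N D σ)) := by
  induction D using Finset.induction_on with
  | empty =>
    have : ∀ σ : Fin d → Fin a, T S N ∅ σ = S := by intro σ; simp [T]
    simp [this]
  | insert i D hi ih =>
    rw [card_insert_of_notMem hi, pow_succ', pow_succ, mul_assoc, mul_assoc,
      ← sum_update i]
    refine (mul_le_mul_right ih _).trans ?_
    rw [mul_left_comm]
    refine mul_le_mul_right ?_ _
    rw [mul_sum]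
    refine sum_le_sum fun σ _ => ?_
    refine (step x (T S N D σ) i a N ?_).trans ?_
    · rintro _ ⟨α, ⟨hα, _⟩, rfl⟩
      simpa [hi] using hS α hα i
    · rw [sum_range]
      exact (sum_congr rfl fun s _ => by rw [T_insert S N D σ i hi s]).le

open Classical in
theorem main_ineq (S : Set (Fin d → ℕ)) (a N : ℕ) (ha : 0 < a) (hS : ∀ α ∈ S, ∀ i, α i ≤ a) :
    ((N - a : ℕ) : ℕ∞) ^ d * len (J x S) ≤
      ((univ.filter fun σ : Fin d → Fin a => ∃ α ∈ S, ∀ i, (σ i : ℕ) < α i).card : ℕ∞) *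
        len (L x fun _ => N) := by
  have h := iter x S a N hS univ
  rw [card_univ, Fintype.card_fin, mul_left_comm] at h
  have ha' : (a : ℕ∞) ^ d ≠ 0 := pow_ne_zero _ (by exact_mod_cast ha.ne')
  have ha'' : (a : ℕ∞) ^ d ≠ ⊤ := by
    rw [← Nat.cast_pow]; exact ENat.natCast_ne_top _
  have h' := (ENat.mul_le_mul_left_iff ha' ha'').mp h
  refine h'.trans ?_
  rw [← nsmul_eq_mul, ← sum_const, sum_filter]
  refine sum_le_sum fun σ _ => ?_
  split_ifs with hσ
  · refine len_anti fun r hr => ?_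
    rw [mem_J]
    rintro _ ⟨α, _, rfl⟩
    simpa using hr
  · have : J x (T S N univ σ) = ⊤ := by
      rw [Ideal.eq_top_iff_one, mem_J]
      rintro _ ⟨α, ⟨hα, h2⟩, rfl⟩
      exact absurd ⟨α, hα, fun i => h2 i (mem_univ i)⟩ hσ
    rw [this, len_top]

end Iter

theorem exists_delta (d m : ℕ) : ∃ E : Finset (Fin d → ℕ),
    (∀ β, β ∈ E ↔ ∑ i, β i ≤ m) ∧ E.card = (m + d).choose d := by
  classical
  refine ⟨(finsuppAntidiag (univ : Finset (Fin (d + 1))) m).image (fun f i => f i.succ), ?_, ?_⟩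
  · intro β
    simp only [mem_image, mem_finsuppAntidiag]
    constructor
    · rintro ⟨f, ⟨hf, _⟩, rfl⟩
      rw [Fin.sum_univ_succ] at hf
      change ∑ i : Fin d, f i.succ ≤ m
      omega
    · intro h
      refine ⟨Finsupp.equivFunOnFinite.symm (Fin.cons (m - ∑ i, β i) β), ⟨?_, by simp⟩, ?_⟩
      · rw [Fin.sum_univ_succ]; simp; omega
      · funext i; simp
  · rw [card_image_of_injOn, card_finsuppAntidiag_nat_eq_choose]
    · simp only [card_univ, Fintype.card_fin]
      have : d + 1 + m - 1 = m + d := by omega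
      rw [this]
      exact Nat.choose_symm_add
    · intro f hf g hg hfg
      simp only [mem_coe, mem_finsuppAntidiag] at hf hg
      have h1 := hf.1
      have h2 := hg.1
      rw [Fin.sum_univ_succ] at h1 h2
      have h3 : ∀ i : Fin d, f i.succ = g i.succ := fun i => congrFun hfg i
      simp only [h3] at h1
      ext i
      refine Fin.cases ?_ (fun i => h3 i) i
      omega

open Filter Topology in
theorem tendsto_choose (k : ℕ) :
    Tendsto (fun u : ℕ => ((u + k).choose k : ℝ) / (u : ℝ) ^ k) atTop (𝓝 (1 / (k.factorial : ℝ))) := by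
  induction k with
  | zero => simp
  | succ k ih =>
    have h1 : Tendsto (fun u : ℕ => (1 + ((k + 1 : ℕ) : ℝ) / (u : ℝ)) / (k + 1 : ℝ)) atTop
        (𝓝 ((1 + 0) / (k + 1 : ℝ))) :=
      (tendsto_const_nhds.add (tendsto_const_div_atTop_nhds_zero_nat _)).div_const _
    have h2 := ih.mul h1
    have e : 1 / (k.factorial : ℝ) * ((1 + 0) / (k + 1 : ℝ)) = 1 / ((k + 1).factorial : ℝ) := by
      rw [Nat.factorial_succ]; push_cast; rw [add_zero, div_mul_div_comm, one_mul, mul_comm]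
    rw [e] at h2
    refine h2.congr' ?_
    filter_upwards [eventually_gt_atTop 0] with u hu
    have hu' : (u : ℝ) ≠ 0 := by exact_mod_cast hu.ne'
    have hc := Nat.add_one_mul_choose_eq (u + k) k
    have hc' : ((u + k + 1 : ℕ) : ℝ) * ((u + k).choose k : ℝ) =
        ((u + (k + 1)).choose (k + 1) : ℝ) * ((k + 1 : ℕ) : ℝ) := by exact_mod_cast hc
    push_cast at hc' ⊢
    have hk : (k + 1 : ℝ) ≠ 0 := by positivity
    rw [pow_succ]
    field_simp
    linear_combination hc'

open Filter Topology in
theorem asymp (d F c a : ℕ) (h : ℕ → ℕ) (e : ℕ → ℤ) (N₀ : ℕ)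
    (hh : ∀ u ≥ N₀, (h u : ℤ) = ∑ i ∈ range (d + 1),
      (-1) ^ i * e i * ((u + d - i).choose (d - i) : ℤ))
    (hF : ∀ t : ℕ, t ≥ N₀ → t ≥ 1 →
      ((t + a + d).choose d) * (t ^ d * F) ≤ c * h ((t + a) * (t + a + d))) :
    (F : ℤ) ≤ c * e 0 ∧ 0 ≤ e 0 := by
  have hfac : (0 : ℝ) < (d.factorial : ℝ) := by exact_mod_cast d.factorial_pos
  have hterm : ∀ i ∈ range (d + 1), Tendsto (fun u : ℕ =>
      (-1 : ℝ) ^ i * (e i : ℝ) * (((u + d - i).choose (d - i) : ℕ) : ℝ) / (u : ℝ) ^ d) atTop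
      (𝓝 (if i = 0 then (e 0 : ℝ) / d.factorial else 0)) := by
    intro i hi
    rw [mem_range] at hi
    have hb := tendsto_choose (d - i)
    have hz : Tendsto (fun u : ℕ => (1 / (u : ℝ)) ^ i) atTop (𝓝 ((0 : ℝ) ^ i)) :=
      (tendsto_const_div_atTop_nhds_zero_nat 1).pow i
    have h3 := ((hb.mul hz).const_mul ((-1 : ℝ) ^ i * (e i : ℝ)))
    have e1 : (-1 : ℝ) ^ i * (e i : ℝ) * (1 / ((d - i).factorial : ℝ) * 0 ^ i) =
        if i = 0 then (e 0 : ℝ) / d.factorial else 0 := by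
      split_ifs with h0
      · subst h0; simp; ring
      · simp [h0]
    rw [e1] at h3
    refine h3.congr' ?_
    filter_upwards [eventually_gt_atTop 0] with u hu
    have hu' : (u : ℝ) ≠ 0 := by exact_mod_cast hu.ne'
    have e2 : u + d - i = u + (d - i) := by omega
    have e3 : (u : ℝ) ^ d = (u : ℝ) ^ (d - i) * (u : ℝ) ^ i := by
      rw [← pow_add]; congr 1; omega
    rw [e2, e3, one_div, inv_pow]
    field_simp
  have hlim : Tendsto (fun u : ℕ => (h u : ℝ) / (u : ℝ) ^ d) atTop
      (𝓝 ((e 0 : ℝ) / d.factorial)) := by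
    have h4 := tendsto_finsetSum _ hterm
    have e4 : ∑ i ∈ range (d + 1), (if i = 0 then (e 0 : ℝ) / d.factorial else 0) =
        (e 0 : ℝ) / d.factorial := by simp
    rw [e4] at h4
    refine h4.congr' ?_
    filter_upwards [eventually_ge_atTop N₀] with u hu
    rw [← sum_div]
    congr 1
    have := hh u hu
    have h5 : ((h u : ℤ) : ℝ) = ((∑ i ∈ range (d + 1),
      (-1) ^ i * e i * ((u + d - i).choose (d - i) : ℤ) : ℤ) : ℝ) := by rw [this]
    push_cast at h5
    exact h5.symm
  have he0 : 0 ≤ (e 0 : ℝ) / d.factorial :=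
    ge_of_tendsto' hlim fun u => by positivity
  have hsub : Tendsto (fun t : ℕ => (t + a) * (t + a + d)) atTop atTop := by
    refine tendsto_atTop_mono' _ ?_ tendsto_id
    filter_upwards [eventually_ge_atTop 1] with t ht
    simp only [id]
    nlinarith
  have hR := (hlim.comp hsub).const_mul (c : ℝ)
  have hL1 : Tendsto (fun t : ℕ => (((t + a) + d).choose d : ℝ) / ((t + a : ℕ) : ℝ) ^ d) atTop
      (𝓝 (1 / (d.factorial : ℝ))) :=
    (tendsto_choose d).comp (tendsto_add_atTop_nat a)
  have hL2 : Tendsto (fun t : ℕ => ((t : ℝ) / ((t : ℝ) + ((a + d : ℕ) : ℝ))) ^ d) atTop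
      (𝓝 (1 ^ d)) := (tendsto_natCast_div_add_atTop _).pow d
  have hL := (hL1.mul hL2).mul_const (F : ℝ)
  have hfin := le_of_tendsto_of_tendsto hL hR (by
    filter_upwards [eventually_ge_atTop N₀, eventually_ge_atTop 1] with t ht0 ht1
    have h6 := hF t ht0 ht1
    have h7 : (((t + a + d).choose d : ℕ) : ℝ) * ((t : ℝ) ^ d * F) ≤
        c * (h ((t + a) * (t + a + d)) : ℝ) := by exact_mod_cast h6
    have htp : (0 : ℝ) < t := by exact_mod_cast ht1
    simp only [Function.comp]
    have e5 : (((t + a) * (t + a + d) : ℕ) : ℝ) ^ d =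
        ((t + a : ℕ) : ℝ) ^ d * ((t : ℝ) + ((a + d : ℕ) : ℝ)) ^ d := by
      rw [← mul_pow]; push_cast; ring
    rw [e5, div_pow, div_mul_div_comm, div_mul_eq_mul_div, ← mul_div_assoc]
    rw [mul_assoc]
    exact div_le_div_of_nonneg_right h7 (by positivity))
  have hfin2 : (F : ℝ) ≤ c * (e 0 : ℝ) := by
    rw [one_pow, mul_one, ← mul_div_assoc, one_div_mul_eq_div] at hfin
    exact (div_le_div_iff_of_pos_right hfac).mp hfin
  constructor
  · exact_mod_cast hfin2
  · have : 0 ≤ (e 0 : ℝ) := by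
      by_contra hneg
      push Not at hneg
      exact absurd (div_neg_of_neg_of_pos hneg hfac) (not_lt.mpr he0)
    exact_mod_cast this

end LimClos

/-- **Claim in Theorem 3.1.** With `Λ_{n+1} = {α : αᵢ ≥ 1, Σαᵢ = n+1}` and
`Q(α) = (x₁^{α₁},…,x_d^{α_d})`, we have
`ℓ(R/⋂_{α ∈ Λ_{n+1}} Q(α)^{lim}) ≤ binom(n+d,d)·e(Q,R)`. -/
theorem stmt7 (R : Type u) [CommRing R] [IsLocalRing R] [IsNoetherianRing R]
    (d : ℕ) (x : Fin d → R) (hx : IsSOP R x)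
    (Q : Ideal R) (hQ : Q = Ideal.span (Set.range x))
    (e : ℕ → ℤ) (he : HasHilbertSeries R d (fun n => Q ^ n) e)
    (n : ℕ) :
    ∃ m : ℕ,
      moduleLength R
        (R ⧸ ⨅ (α : Fin d → ℕ) (_ : (∀ i, 1 ≤ α i) ∧ ∑ i, α i = n + 1),
          limitClosure R fun i => x i ^ α i) = (m : WithBot ℕ∞) ∧
      (m : ℤ) ≤ ((n + d).choose d : ℤ) * e 0 := by
  classical
  obtain ⟨N₀, hN⟩ := he
  choose! h hh1 hh2 using hN
  have hlen : ∀ u ≥ N₀, LimClos.len (Q ^ (u + 1)) = (h u : ℕ∞) := by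
    intro u hu
    have h1 := hh1 u hu
    unfold moduleLength at h1
    rw [← Module.coe_length] at h1
    exact WithBot.coe_injective h1
  set S : Set (Fin d → ℕ) := {α | (∀ i, 1 ≤ α i) ∧ ∑ i, α i = n + 1} with hSdef
  have hS : ∀ α ∈ S, ∀ i, α i ≤ n + 1 := by
    intro α hα i
    rw [← hα.2]
    exact Finset.single_le_sum (f := α) (fun _ _ => Nat.zero_le _) (Finset.mem_univ i)
  set c : ℕ := (Finset.univ.filter
    fun σ : Fin d → Fin (n + 1) => ∃ α ∈ S, ∀ i, (σ i : ℕ) < α i).card with hc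
  have hcle : c ≤ (n + d).choose d := by
    obtain ⟨E, hE, hEc⟩ := LimClos.exists_delta d n
    rw [← hEc]
    refine Finset.card_le_card_of_injOn (fun σ i => (σ i : ℕ)) ?_ ?_
    · intro σ hσ
      simp only [Finset.coe_filter, Finset.mem_univ, true_and, Set.mem_ofPred_eq] at hσ
      obtain ⟨α, hα, hlt⟩ := hσ
      rw [Finset.mem_coe, hE]
      rcases Nat.eq_zero_or_pos d with h0 | hpos
      · subst h0; simp
      · have : ∑ i, (σ i : ℕ) < ∑ i, α i :=
          Finset.sum_lt_sum_of_nonempty ⟨⟨0, hpos⟩, Finset.mem_univ _⟩ fun i _ => hlt i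
        rw [hα.2] at this
        exact Nat.lt_succ_iff.mp this
    · intro σ _ τ _ hst
      funext i
      exact Fin.ext (congrFun hst i)
  have key : ∀ t : ℕ, t ≥ N₀ → t ≥ 1 →
      (((t + (n + 1) + d).choose d : ℕ) : ℕ∞) * ((t : ℕ∞) ^ d * LimClos.len (LimClos.J x S)) ≤
        (c : ℕ∞) * (h ((t + (n + 1)) * (t + (n + 1) + d)) : ℕ∞) := by
    intro t ht0 ht1
    have h1 := LimClos.main_ineq x S (n + 1) (t + (n + 1)) (Nat.succ_pos n) hS
    rw [Nat.add_sub_cancel] at h1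
    obtain ⟨E, hE, hEc⟩ := LimClos.exists_delta d (t + (n + 1))
    have h2 := LimClos.box_le x (t + (n + 1)) E
      (Q ^ ((t + (n + 1)) * (t + (n + 1) + d) + 1)) (by
        intro β hβ
        rw [hE] at hβ
        rw [hQ]
        refine LimClos.pow_le_of_pow_mem x _ _
          (fun i => (t + (n + 1)) + (t + (n + 1)) * β i) ?_
          (fun i => LimClos.pow_mem_L x le_rfl)
        rw [Finset.sum_add_distrib, ← Finset.mul_sum]
        simp only [Finset.sum_const, Finset.card_univ, Fintype.card_fin, smul_eq_mul]
        nlinarith)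
    rw [hlen _ (by nlinarith), hEc] at h2
    calc _ ≤ (((t + (n + 1) + d).choose d : ℕ) : ℕ∞) *
          ((c : ℕ∞) * LimClos.len (LimClos.L x fun _ => t + (n + 1))) := by gcongr
      _ = (c : ℕ∞) * ((((t + (n + 1) + d).choose d : ℕ) : ℕ∞) *
          LimClos.len (LimClos.L x fun _ => t + (n + 1))) := mul_left_comm _ _ _
      _ ≤ _ := by gcongr
  have hfin : LimClos.len (LimClos.J x S) ≠ ⊤ := by
    intro htop
    have h1 := key (max N₀ 1) (le_max_left _ _) (le_max_right _ _)
    have hne1 : (((max N₀ 1 + (n + 1) + d).choose d : ℕ) : ℕ∞) ≠ 0 := by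
      exact_mod_cast (Nat.choose_pos (by omega)).ne'
    have hne2 : ((max N₀ 1 : ℕ) : ℕ∞) ^ d ≠ 0 := pow_ne_zero _ (by
      have : max N₀ 1 ≠ 0 := by omega
      exact_mod_cast this)
    rw [htop, ENat.mul_top hne2, ENat.mul_top hne1, top_le_iff] at h1
    exact ENat.natCast_ne_top _ (by exact_mod_cast h1)
  obtain ⟨F, hF⟩ := ENat.ne_top_iff_exists.mp hfin
  obtain ⟨hmain, he0⟩ := LimClos.asymp d F c (n + 1) h e N₀ hh2 (by
    intro t ht0 ht1
    have h1 := key t ht0 ht1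
    rw [← hF] at h1
    exact_mod_cast h1)
  have hle : LimClos.J x S ≤ ⨅ (α : Fin d → ℕ) (_ : (∀ i, 1 ≤ α i) ∧ ∑ i, α i = n + 1),
      limitClosure R fun i => x i ^ α i := by
    refine le_iInf₂ fun α hα => ?_
    exact (iInf₂_le α hα).trans (LimClos.L_le_limitClosure x hα.1)
  have h3 := LimClos.len_anti hle
  rw [← hF] at h3
  obtain ⟨m, hm, hmF⟩ := ENat.le_natCast_iff.mp h3
  refine ⟨m, ?_, ?_⟩
  · unfold moduleLength
    rw [← Module.coe_length]
    unfold LimClos.len at hm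
    rw [hm]; rfl
  · calc (m : ℤ) ≤ F := by exact_mod_cast hmF
      _ ≤ c * e 0 := hmain
      _ ≤ _ := mul_le_mul_of_nonneg_right (by exact_mod_cast hcle) he0
end

section
/- Let (R,m) be a Noetherian local ring of dimension d, let Q = (x₁,…,x_d) be a parameter ideal, let S = R[[y₁,…,y_d]] be a power series ring over R, and let q = (y₁−x₁,…,y_d−x_d) ⊆ S. Then e(Q,R) = e((y₁,…,y_d); S/q), and for every n ≥ 0, e((y₁,…,y_d); S/q^{n+1}) = binom(n+d,d)·e(Q,R), where e((y₁,…,y_d); M) denotes the multiplicity of the ideal (y₁,…,y_d) on the module M. -/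
open IsLocalRing

universe u

namespace Stmt10Aux

open MvPolynomial in
theorem card_exps (d n : ℕ) :
    ((Finset.range (n+1)).biUnion
      (fun i => (Finset.univ : Finset (Fin d)).finsuppAntidiag i)).card = (n + d).choose d := by
  classical
  rw [Finset.card_biUnion]
  · simp only [Finset.card_finsuppAntidiag_nat_eq_multichoose, Finset.card_univ, Fintype.card_fin]
    have : ∑ i ∈ Finset.range (n+1), Nat.multichoose d i = Nat.multichoose (d+1) n := by
      induction n with
      | zero => simp
      | succ n ih => rw [Finset.sum_range_succ, ih, Nat.multichoose_succ_succ, add_comm]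
    rw [this, Nat.multichoose_eq, show d + 1 + n - 1 = n + d by omega]
    exact Nat.choose_symm_add
  · intro i _ j _ hij
    rw [Function.onFun, Finset.disjoint_left]
    intro a ha hb
    simp only [Finset.mem_finsuppAntidiag] at ha hb
    exact hij (ha.1.symm.trans hb.1)

theorem mem_exps {d n : ℕ} (a : Fin d →₀ ℕ) :
    a ∈ ((Finset.range (n+1)).biUnion
      (fun i => (Finset.univ : Finset (Fin d)).finsuppAntidiag i)) ↔ a.degree ≤ n := by
  simp [Finsupp.degree_eq_sum, Finset.mem_finsuppAntidiag]

theorem length_quot {R P A : Type*} [CommRing R] [AddCommGroup P] [Module R P] [AddCommGroup A]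
    [Module R A] (f : P →ₗ[R] A) (hf : Function.Surjective f) (K : Submodule R P)
    (hK : ∀ p, f p = 0 ↔ p ∈ K) : Module.length R (P ⧸ K) = Module.length R A := by
  have : K = LinearMap.ker f := by ext p; simp [hK]
  subst this
  exact (f.quotKerEquivOfSurjective hf).length_eq

section
variable {R : Type*} [CommRing R] {d : ℕ}
open MvPolynomial

noncomputable def shift (x : Fin d → R) : MvPolynomial (Fin d) R ≃ₐ[R] MvPolynomial (Fin d) R :=
  AlgEquiv.ofAlgHom (aeval fun i => X i + C (x i)) (aeval fun i => X i - C (x i))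
    (by ext i; simp [← algebraMap_eq]) (by ext i; simp [← algebraMap_eq])

theorem shift_map (x : Fin d → R) :
    (Ideal.span (Set.range fun i => (X i - C (x i) : MvPolynomial (Fin d) R))).map
      (shift x : MvPolynomial (Fin d) R →+* _) = idealOfVars (Fin d) R := by
  rw [Ideal.map_span, ← Set.range_comp]
  congr 2
  ext i
  simp [shift, ← algebraMap_eq]

theorem L1 (x : Fin d → R) (I : Ideal R) (n : ℕ) :
    Module.length R (MvPolynomial (Fin d) R ⧸
      ((Ideal.span (Set.range fun i => (X i - C (x i) : MvPolynomial (Fin d) R)) ^ (n+1)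
        ⊔ I.map C).restrictScalars R)) = ((n+d).choose d : ℕ) * Module.length R (R ⧸ I) := by
  classical
  set s := ((Finset.range (n+1)).biUnion
      (fun i => (Finset.univ : Finset (Fin d)).finsuppAntidiag i)) with hs
  let φ : MvPolynomial (Fin d) R →ₗ[R] (s → R ⧸ I) :=
    LinearMap.pi fun a => I.mkQ ∘ₗ lcoeff R a.1
  have hφ : Function.Surjective φ := by
    intro v
    choose w hw using fun a => Submodule.mkQ_surjective I (v a)
    refine ⟨∑ a : s, monomial a.1 (w a), ?_⟩
    ext a
    rw [← hw]
    simp only [φ, LinearMap.pi_apply, LinearMap.comp_apply, lcoeff_apply, coeff_sum,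
      coeff_monomial]
    congr 1
    rw [Finset.sum_eq_single a]
    · simp
    · intro b _ hb; rw [if_neg]; intro h; exact hb (Subtype.ext h)
    · simp
  have hk : ∀ p, φ p = 0 ↔ p ∈ idealOfVars (Fin d) R ^ (n+1) ⊔ I.map C := by
    intro p
    have h1 : φ p = 0 ↔ ∀ a : Fin d →₀ ℕ, a.degree ≤ n → p.coeff a ∈ I := by
      simp only [funext_iff, φ, LinearMap.pi_apply, LinearMap.comp_apply, Pi.zero_apply,
        Submodule.mkQ_apply, Submodule.Quotient.mk_eq_zero, lcoeff_apply, Subtype.forall, hs,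
        mem_exps]
    rw [h1]
    constructor
    · intro h
      rw [← sub_add_cancel p (∑ a ∈ s, monomial a (p.coeff a))]
      refine Submodule.add_mem_sup ?_ ?_
      · rw [mem_pow_idealOfVars_iff']
        intro a ha
        have : a ∈ s := (mem_exps a).2 (Nat.lt_succ_iff.1 ha)
        simp [coeff_sum, coeff_monomial, this]
      · rw [mem_map_C_iff]
        intro a
        simp only [coeff_sum, coeff_monomial, Finset.sum_ite_eq']
        split_ifs with h2
        · exact h a ((mem_exps a).1 h2)
        · exact I.zero_mem
    · intro h a ha
      obtain ⟨u, hu, v, hv, rfl⟩ := Submodule.mem_sup.1 h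
      rw [mem_pow_idealOfVars_iff'] at hu
      rw [mem_map_C_iff] at hv
      rw [coeff_add, hu a (by omega), zero_add]
      exact hv a
  rw [length_quot (φ ∘ₗ (shift x).toLinearMap) (hφ.comp (shift x).surjective)]
  · rw [Module.length_pi, ENat.card_eq_coe_fintype_card, Fintype.card_coe, hs, card_exps]
  · intro p
    have hm : (Ideal.span (Set.range fun i => (X i - C (x i) : MvPolynomial (Fin d) R)) ^ (n+1)
        ⊔ I.map C).map (shift x : MvPolynomial (Fin d) R →+* _)
        = idealOfVars (Fin d) R ^ (n+1) ⊔ I.map C := by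
      rw [Ideal.map_sup, Ideal.map_pow, shift_map, Ideal.map_map]
      congr 2
      ext r : 1
      exact (shift x).commutes r
    rw [LinearMap.comp_apply, hk, ← hm]
    have := Ideal.mem_map_of_equiv (I := (Ideal.span (Set.range fun i => (X i - C (x i) : MvPolynomial (Fin d) R)) ^ (n+1)
        ⊔ I.map C)) (shift x) (shift x p)
    refine Iff.trans this ⟨?_, fun h => ⟨p, h, rfl⟩⟩
    rintro ⟨y, hy, hyp⟩
    rw [← (shift x).injective hyp]
    exact hy

theorem sandwich (x : Fin d → R) (n m : ℕ) :
    (Ideal.span (Set.range fun i => (X i - C (x i) : MvPolynomial (Fin d) R)) ^ (n+1)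
        ⊔ idealOfVars (Fin d) R ^ (n+1+m)) ≤
    (Ideal.span (Set.range fun i => (X i - C (x i) : MvPolynomial (Fin d) R)) ^ (n+1)
        ⊔ ((Ideal.span (Set.range x))^m).map C) ∧
    (Ideal.span (Set.range fun i => (X i - C (x i) : MvPolynomial (Fin d) R)) ^ (n+1)
        ⊔ ((Ideal.span (Set.range x))^(n+1+m)).map C) ≤
    (Ideal.span (Set.range fun i => (X i - C (x i) : MvPolynomial (Fin d) R)) ^ (n+1)
        ⊔ idealOfVars (Fin d) R ^ m) := by
  set q := Ideal.span (Set.range fun i => (X i - C (x i) : MvPolynomial (Fin d) R)) with hq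
  have hqi : ∀ i, (X i - C (x i) : MvPolynomial (Fin d) R) ∈ q := fun i =>
    Ideal.subset_span ⟨i, rfl⟩
  have h1 : idealOfVars (Fin d) R ≤ q ⊔ (Ideal.span (Set.range x)).map C := by
    rw [Ideal.span_le]
    rintro _ ⟨i, rfl⟩
    rw [← sub_add_cancel (X i) (C (x i))]
    exact Submodule.add_mem_sup (hqi i) (Ideal.mem_map_of_mem _ (Ideal.subset_span ⟨i, rfl⟩))
  have h2 : (Ideal.span (Set.range x)).map C ≤ q ⊔ idealOfVars (Fin d) R := by
    rw [Ideal.map_le_iff_le_comap, Ideal.span_le]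
    rintro _ ⟨i, rfl⟩
    have : (C (x i) : MvPolynomial (Fin d) R) = - (X i - C (x i)) + X i := by ring
    show C (x i) ∈ q ⊔ idealOfVars (Fin d) R
    rw [this]
    exact Submodule.add_mem_sup (q.neg_mem (hqi i)) (Ideal.subset_span ⟨i, rfl⟩)
  rw [Ideal.map_pow, Ideal.map_pow]
  exact ⟨sup_le le_sup_left ((Ideal.pow_right_mono h1 _).trans Ideal.sup_pow_add_le_pow_sup_pow),
    sup_le le_sup_left ((Ideal.pow_right_mono h2 _).trans Ideal.sup_pow_add_le_pow_sup_pow)⟩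

theorem length_quot_anti {R P : Type*} [CommRing R] [AddCommGroup P] [Module R P]
    {K L : Submodule R P} (h : K ≤ L) : Module.length R (P ⧸ L) ≤ Module.length R (P ⧸ K) :=
  Module.length_le_of_surjective (Submodule.factor h) (Submodule.factor_surjective h)
end

section
open Filter Topology
theorem tendsto_choose (a c d : ℕ) (h : a ≤ d) :
    Tendsto (fun k : ℕ => ((k + c).choose a : ℝ) / (k:ℝ)^d) atTop
      (𝓝 (if a = d then 1 / (d.factorial : ℝ) else 0)) := by
  have h0 : Tendsto (fun k : ℕ => ((k + c : ℕ) : ℝ) / (k:ℝ)) atTop (𝓝 1) := by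
    have : Tendsto (fun k : ℕ => (1:ℝ) + (c:ℝ) / (k:ℝ)) atTop (𝓝 (1 + 0)) :=
      tendsto_const_nhds.add (tendsto_const_div_atTop_nhds_zero_nat _)
    rw [add_zero] at this
    refine this.congr' ?_
    filter_upwards [eventually_gt_atTop 0] with k hk
    have : (k:ℝ) ≠ 0 := by positivity
    push_cast; field_simp
  have h1 : Tendsto (fun k : ℕ => ((k + c).choose a : ℝ) / (((k + c : ℕ) : ℝ)^a)) atTop
      (𝓝 (1 / (a.factorial : ℝ))) := by
    have h2 : Tendsto (fun k : ℕ => (k.choose a : ℝ) / ((k : ℝ)^a)) atTop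
      (𝓝 (1 / (a.factorial : ℝ))) := by
      have hz : ∀ᶠ k : ℕ in atTop, ((k:ℝ)^a / a.factorial) ≠ 0 := by
        filter_upwards [eventually_gt_atTop 0] with k hk
        positivity
      have := (Asymptotics.isEquivalent_iff_tendsto_one hz).1 (isEquivalent_choose a)
      have := this.mul_const (1 / (a.factorial : ℝ))
      rw [one_mul] at this
      refine this.congr' ?_
      filter_upwards [eventually_gt_atTop 0] with k hk
      simp only [Pi.div_apply]
      field_simp
    exact h2.comp (tendsto_add_atTop_nat c)
  have h3 : Tendsto (fun k : ℕ => (1:ℝ) / (k:ℝ)^(d-a)) atTop (𝓝 (if a = d then 1 else 0)) := by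
    split_ifs with h
    · subst h; simp
    · exact tendsto_const_nhds.div_atTop
        ((tendsto_pow_atTop (by omega)).comp tendsto_natCast_atTop_atTop)
  have := (h1.mul (h0.pow a)).mul h3
  have e : (1 / (a.factorial : ℝ)) * 1 ^ a * (if a = d then 1 else 0) =
    (if a = d then 1 / (d.factorial : ℝ) else 0) := by
    split_ifs with h
    · subst h; simp
    · simp
  rw [e] at this
  refine this.congr' ?_
  filter_upwards [eventually_gt_atTop 0] with k hk
  have h5 : (k:ℝ)^d = (k:ℝ)^a * (k:ℝ)^(d-a) := by rw [← pow_add]; congr 1; omega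
  have : (((k+c : ℕ)):ℝ) ≠ 0 := by positivity
  rw [h5, div_pow]
  field_simp

/-- The Hilbert polynomial. -/
def hilb (d : ℕ) (e : ℕ → ℤ) (n : ℕ) : ℤ :=
  ∑ i ∈ Finset.range (d + 1), (-1) ^ i * e i * ((n + d - i).choose (d - i) : ℤ)

theorem tendsto_hilb (d c : ℕ) (e : ℕ → ℤ) :
    Tendsto (fun k : ℕ => ((hilb d e (k + c) : ℤ) : ℝ) / (k:ℝ)^d) atTop
      (𝓝 ((e 0 : ℝ) / d.factorial)) := by
  have h : Tendsto (fun k : ℕ => ∑ i ∈ Finset.range (d + 1), ((-1) ^ i * e i : ℝ) *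
      (((k + (c + (d - i))).choose (d - i) : ℝ) / (k:ℝ)^d)) atTop
      (𝓝 (∑ i ∈ Finset.range (d + 1), ((-1) ^ i * e i : ℝ) *
        (if d - i = d then 1 / (d.factorial : ℝ) else 0))) :=
    tendsto_finsetSum _ fun i _ => (tendsto_choose _ _ _ (Nat.sub_le _ _)).const_mul _
  have e1 : (∑ i ∈ Finset.range (d + 1), ((-1) ^ i * e i : ℝ) *
        (if d - i = d then 1 / (d.factorial : ℝ) else 0)) = (e 0 : ℝ) / d.factorial := by
    rw [Finset.sum_eq_single 0]
    · simp [div_eq_mul_inv]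
    · intro i hi h0
      rw [Finset.mem_range] at hi
      rw [if_neg (by omega), mul_zero]
    · simp
  rw [e1] at h
  refine h.congr fun k => ?_
  rw [hilb, Int.cast_sum, Finset.sum_div]
  refine Finset.sum_congr rfl fun i hi => ?_
  rw [Finset.mem_range] at hi
  rw [show k + c + d - i = k + (c + (d - i)) by omega]
  push_cast
  ring

theorem lead_eq (d N c c' : ℕ) (e g : ℕ → ℤ)
    (h : ∀ᶠ k in atTop, (N : ℤ) * hilb d e k ≤ hilb d g (k + c) ∧
      hilb d g (k + c) ≤ N * hilb d e (k + c')) : g 0 = N * e 0 := by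
  have h1 := (tendsto_hilb d 0 e).const_mul (N : ℝ)
  have h2 := tendsto_hilb d c g
  have h3 := (tendsto_hilb d c' e).const_mul (N : ℝ)
  have a := le_of_tendsto_of_tendsto h1 h2 (by
    filter_upwards [h] with k hk
    rw [← mul_div_assoc]
    gcongr
    exact_mod_cast hk.1)
  have b := le_of_tendsto_of_tendsto h2 h3 (by
    filter_upwards [h] with k hk
    rw [← mul_div_assoc]
    gcongr
    exact_mod_cast hk.2)
  have := le_antisymm b a
  have h4 : (d.factorial : ℝ) ≠ 0 := by positivity
  field_simp at this
  exact_mod_cast this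
end


theorem length_restrict {R S : Type*} [CommRing R] [CommRing S] [Algebra R S] (J : Ideal S)
    (hJ : ∀ s : S, ∃ r : R, s - algebraMap R S r ∈ J) (k : ℕ) :
    ∀ (M : Type*) [AddCommGroup M] [Module R M] [Module S M] [IsScalarTower R S M],
      (∀ j ∈ J ^ k, ∀ m : M, j • m = 0) → Module.length S M = Module.length R M := by
  induction k with
  | zero =>
    intro M _ _ _ _ h
    have : Subsingleton M := ⟨fun a b => by
      rw [← one_smul S a, ← one_smul S b, h 1 (by simp), h 1 (by simp)]⟩
    simp
  | succ k ih =>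
    intro M _ _ _ _ h
    let N : Submodule S M := J • ⊤
    have hN : Module.length S N = Module.length R N := by
      refine ih N ?_
      rintro j hj ⟨m, hm⟩
      apply Subtype.ext
      show j • m = 0
      refine Submodule.smul_induction_on hm ?_ ?_
      · intro r hr n _
        rw [← mul_smul]
        exact h _ (by rw [pow_succ]; exact Ideal.mul_mem_mul hj hr) n
      · intro x y hx hy; rw [smul_add, hx, hy, add_zero]
    have hQ : Module.length S (M ⧸ N) = Module.length R (M ⧸ N) := by
      apply WithBot.coe_injective
      rw [Module.coe_length, Module.coe_length]
      refine Order.krullDim_eq_of_orderIso (RelIso.ofSurjective (Submodule.restrictScalarsEmbedding R S (M ⧸ N)) ?_)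
      intro L
      refine ⟨{ L with smul_mem' := ?_ }, ?_⟩
      · intro s m hm
        obtain ⟨r, hr⟩ := hJ s
        have : s • m = r • m := by
          obtain ⟨m, rfl⟩ := Submodule.mkQ_surjective N m
          rw [← sub_eq_zero, ← algebraMap_smul S r, ← sub_smul, ← map_smul]
          rw [Submodule.mkQ_apply, Submodule.Quotient.mk_eq_zero]
          exact Submodule.smul_mem_smul hr trivial
        rw [this]
        exact L.smul_mem r hm
      · ext m; rfl
    have e1 : Module.length S M = Module.length S N + Module.length S (M ⧸ N) :=
      Module.length_eq_add_of_exact N.subtype N.mkQ (Submodule.subtype_injective _)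
        (Submodule.mkQ_surjective _) (LinearMap.exact_subtype_mkQ N)
    let f : N →ₗ[R] M := N.subtype.restrictScalars R
    let g : M →ₗ[R] (M ⧸ N) := N.mkQ.restrictScalars R
    have hf : Function.Injective f := Submodule.subtype_injective N
    have hg : Function.Surjective g := Submodule.mkQ_surjective N
    have hfg : Function.Exact f g := LinearMap.exact_subtype_mkQ N
    have e2 : Module.length R M = Module.length R N + Module.length R (M ⧸ N) :=
      Module.length_eq_add_of_exact f g hf hg hfg
    rw [e1, e2, hN, hQ]

section
variable {R : Type*} [CommRing R] {d : ℕ}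
open MvPowerSeries

theorem mem_J_pow_of (k : ℕ) : ∀ f : MvPowerSeries (Fin d) R,
    (∀ a : Fin d →₀ ℕ, a.degree < k → coeff a f = 0) →
    f ∈ (Ideal.span (Set.range fun i => (X i : MvPowerSeries (Fin d) R))) ^ k := by
  classical
  induction k with
  | zero => intro f _; simp
  | succ k ih =>
    intro f hf
    have hch : ∀ a : Fin d →₀ ℕ, ∃ i : Option (Fin d), (a ≠ 0 → ∃ j, i = some j ∧ a j ≠ 0) := by
      intro a
      by_cases h : a = 0
      · exact ⟨none, fun h' => (h' h).elim⟩
      · obtain ⟨j, hj⟩ := Finsupp.ne_iff.1 h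
        exact ⟨some j, fun _ => ⟨j, rfl, hj⟩⟩
    choose ι hι using hch
    let g : Fin d → MvPowerSeries (Fin d) R := fun i a =>
      if ι (a + Finsupp.single i 1) = some i then coeff (a + Finsupp.single i 1) f else 0
    have hg : ∀ i a, coeff a (g i) = if ι (a + Finsupp.single i 1) = some i
      then coeff (a + Finsupp.single i 1) f else 0 := fun i a => rfl
    have hfg : f = ∑ i, g i * X i := by
      ext a
      rw [map_sum]
      simp_rw [mul_comm (g _), X, coeff_monomial_mul, one_mul]
      by_cases ha : a = 0
      · subst ha
        rw [hf 0 (by simp)]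
        symm
        refine Finset.sum_eq_zero fun i _ => ?_
        rw [if_neg]
        simp
      · obtain ⟨j, hj, haj⟩ := hι a ha
        rw [Finset.sum_eq_single j]
        · have hle : Finsupp.single j 1 ≤ a := by
            rw [Finsupp.single_le_iff]; omega
          rw [if_pos hle, hg, tsub_add_cancel_of_le hle, if_pos hj]
        · intro b _ hb
          split_ifs with hle
          · rw [hg, tsub_add_cancel_of_le hle, if_neg]
            rw [hj]; intro h; exact hb (Option.some.inj h).symm
          · rfl
        · simp
    rw [hfg, pow_succ]
    refine Ideal.sum_mem _ fun i _ => Ideal.mul_mem_mul (ih _ ?_) (Ideal.subset_span ⟨i, rfl⟩)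
    intro a ha
    rw [hg]
    split_ifs
    · exact hf _ (by rw [map_add, Finsupp.degree_single]; omega)
    · rfl

theorem order_of_mem_J_pow (k : ℕ) : ∀ f ∈ (Ideal.span (Set.range fun i => (X i : MvPowerSeries (Fin d) R))) ^ k,
    (k : ℕ∞) ≤ f.order := by
  have h1 : ∀ f ∈ (Ideal.span (Set.range fun i => (X i : MvPowerSeries (Fin d) R))), 1 ≤ f.order := by
    intro f hf
    rw [one_le_order_iff_constCoeff_eq_zero]
    have : (Ideal.span (Set.range fun i => (X i : MvPowerSeries (Fin d) R))) ≤
      RingHom.ker (constantCoeff (σ := Fin d) (R := R)) := by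
      rw [Ideal.span_le]; rintro _ ⟨i, rfl⟩; simp [RingHom.mem_ker]
    exact this hf
  induction k with
  | zero => simp
  | succ k ih =>
    intro f hf
    rw [pow_succ] at hf
    refine Submodule.mul_induction_on hf ?_ ?_
    · intro a ha b hb
      push_cast
      exact (add_le_add (ih a ha) (h1 b hb)).trans le_order_mul
    · intro a b ha hb
      exact (le_min ha hb).trans min_order_le_add

theorem L2 (qP : Ideal (MvPolynomial (Fin d) R)) (k : ℕ) (a J : Ideal (MvPowerSeries (Fin d) R))
    (hJ : J = Ideal.span (Set.range fun i => (X i : MvPowerSeries (Fin d) R)))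
    (ha : a = qP.map MvPolynomial.coeToMvPowerSeries.ringHom) :
    Module.length (MvPowerSeries (Fin d) R) ((MvPowerSeries (Fin d) R ⧸ a) ⧸
      (J ^ k • (⊤ : Submodule (MvPowerSeries (Fin d) R) (MvPowerSeries (Fin d) R ⧸ a)))) =
    Module.length R (MvPolynomial (Fin d) R ⧸
      ((qP ⊔ MvPolynomial.idealOfVars (Fin d) R ^ k).restrictScalars R)) := by
  set S := MvPowerSeries (Fin d) R with hS
  have htrunc : ∀ (k : ℕ) (s : S), ∃ p : MvPolynomial (Fin d) R, s - (p : S) ∈ J ^ k := by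
    intro k s
    refine ⟨truncTotal k s, ?_⟩
    rw [hJ]
    apply mem_J_pow_of
    intro b hb
    rw [map_sub, MvPolynomial.coeff_coe, coeff_truncTotal _ hb, sub_self]
  have hback : ∀ p : MvPolynomial (Fin d) R, (p : S) ∈ J ^ k →
      p ∈ MvPolynomial.idealOfVars (Fin d) R ^ k := by
    intro p hp
    rw [MvPolynomial.mem_pow_idealOfVars_iff']
    intro b hb
    rw [← MvPolynomial.coeff_coe]
    apply coeff_of_lt_order
    rw [hJ] at hp
    exact lt_of_lt_of_le (by exact_mod_cast hb) (order_of_mem_J_pow k _ hp)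
  have hforw : (MvPolynomial.idealOfVars (Fin d) R).map MvPolynomial.coeToMvPowerSeries.ringHom = J := by
    rw [Ideal.map_span, ← Set.range_comp, hJ]
    congr 2
    ext i : 1
    simp
  rw [length_restrict (R := R) J ?_ k]
  · symm
    let π : S →ₗ[S] ((S ⧸ a) ⧸ (J ^ k • (⊤ : Submodule S (S ⧸ a)))) :=
      Submodule.mkQ _ ∘ₗ Submodule.mkQ a
    have hπs : Function.Surjective π :=
      (Submodule.mkQ_surjective _).comp (Submodule.mkQ_surjective _)
    have hπ : ∀ s, π s = 0 ↔ s ∈ a ⊔ J ^ k := by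
      intro s
      have : (J ^ k • (⊤ : Submodule S (S ⧸ a))) = Submodule.map (Submodule.mkQ a) (J ^ k) := by
        rw [← Submodule.range_mkQ a, LinearMap.range_eq_map, ← Submodule.map_smul'', smul_eq_mul,
          Ideal.mul_top]
      rw [LinearMap.comp_apply, Submodule.mkQ_apply, Submodule.Quotient.mk_eq_zero, this,
        ← Submodule.mem_comap, Submodule.comap_map_mkQ]
    let ι : MvPolynomial (Fin d) R →ₗ[R] S := (MvPolynomial.coeToMvPowerSeries.algHom R).toLinearMap
    have hι : ∀ p, ι p = (p : S) := fun p => by simp [ι, MvPolynomial.coeToMvPowerSeries.algHom_apply]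
    refine length_quot (π.restrictScalars R ∘ₗ ι) ?_ _ ?_
    · intro z
      obtain ⟨s, rfl⟩ := hπs z
      obtain ⟨p, hp⟩ := htrunc k s
      refine ⟨p, ?_⟩
      rw [LinearMap.comp_apply, hι]
      show π p = π s
      rw [eq_comm, ← sub_eq_zero, ← map_sub, hπ]
      exact Submodule.mem_sup_right hp
    · intro p
      rw [LinearMap.comp_apply, hι]
      show π p = 0 ↔ _
      rw [hπ]
      constructor
      · intro h
        obtain ⟨u, hu, v, hv, huv⟩ := Submodule.mem_sup.1 h
        have key : ∀ u ∈ a, ∃ p' ∈ qP, u - (p' : S) ∈ J ^ k := by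
          intro u hu
          rw [ha] at hu
          refine Submodule.span_induction ?_ ?_ ?_ ?_ hu
          · rintro _ ⟨p', hp', rfl⟩
            exact ⟨p', hp', by simp⟩
          · exact ⟨0, qP.zero_mem, by simp⟩
          · rintro x y _ _ ⟨p₁, h₁, h₁'⟩ ⟨p₂, h₂, h₂'⟩
            refine ⟨p₁ + p₂, qP.add_mem h₁ h₂, ?_⟩
            have := (J ^ k).add_mem h₁' h₂'
            convert this using 1
            push_cast; ring
          · rintro s x _ ⟨p₁, h₁, h₁'⟩
            obtain ⟨t, ht⟩ := htrunc k s
            refine ⟨t * p₁, qP.mul_mem_left _ h₁, ?_⟩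
            have := (J ^ k).add_mem ((J ^ k).mul_mem_left s h₁') ((J ^ k).mul_mem_left (p₁ : S) ht)
            convert this using 1
            rw [smul_eq_mul, MvPolynomial.coe_mul]; ring
        obtain ⟨p', hp', hu'⟩ := key u hu
        have : p - p' ∈ MvPolynomial.idealOfVars (Fin d) R ^ k := by
          apply hback
          have := (J ^ k).add_mem hu' hv
          convert this using 1
          rw [← MvPolynomial.coeToMvPowerSeries.ringHom_apply, map_sub]
          simp only [MvPolynomial.coeToMvPowerSeries.ringHom_apply]
          rw [← huv]; ring
        show p ∈ qP ⊔ _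
        rw [← add_sub_cancel p' p]
        exact Submodule.add_mem_sup hp' this
      · intro h
        change p ∈ qP ⊔ _ at h
        have := Ideal.mem_map_of_mem MvPolynomial.coeToMvPowerSeries.ringHom h
        rw [Ideal.map_sup, Ideal.map_pow, hforw, ← ha] at this
        exact this
  · intro j hj m
    obtain ⟨m, rfl⟩ := Submodule.mkQ_surjective _ m
    rw [← map_smul, Submodule.mkQ_apply, Submodule.Quotient.mk_eq_zero]
    exact Submodule.smul_mem_smul hj trivial
  · intro s
    refine ⟨constantCoeff s, ?_⟩
    rw [hJ, ← pow_one (Ideal.span _)]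
    apply mem_J_pow_of
    intro b hb
    have : b = 0 := by rw [← Finsupp.degree_eq_zero_iff]; omega
    subst this
    simp [MvPowerSeries.algebraMap_apply]
end

theorem main (R : Type u) [CommRing R]
    (d : ℕ) (x : Fin d → R)
    (Q : Ideal R) (hQdef : Q = Ideal.span (Set.range x))
    (e : ℕ → ℤ) (he : HasHilbertSeries R d (fun n => Q ^ n) e)
    (q J a : Ideal (MvPowerSeries (Fin d) R))
    (hq : q = Ideal.span (Set.range fun i =>
      (MvPowerSeries.X i : MvPowerSeries (Fin d) R) - MvPowerSeries.C (σ := Fin d) (R := R) (x i)))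
    (hJ : J = Ideal.span (Set.range fun i =>
      (MvPowerSeries.X i : MvPowerSeries (Fin d) R)))
    (n : ℕ) (ha : a = q ^ (n + 1)) (g : ℕ → ℤ)
    (hg : HasHilbertSeriesMod (MvPowerSeries (Fin d) R) (MvPowerSeries (Fin d) R ⧸ a) d J g) :
    g 0 = ((n + d).choose d : ℤ) * e 0 := by
  obtain ⟨N₁, h₁⟩ := he
  obtain ⟨N₂, h₂⟩ := hg
  have hlen : ∀ (A M : Type u) [CommRing A] [AddCommGroup M] [Module A M] (m : ℕ),
      moduleLength A M = (m : WithBot ℕ∞) → Module.length A M = (m : ℕ∞) := by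
    intro A M _ _ _ m h
    apply WithBot.coe_injective
    rw [Module.coe_length]
    exact h
  let qP : Ideal (MvPolynomial (Fin d) R) :=
    Ideal.span (Set.range fun i => (MvPolynomial.X i - MvPolynomial.C (x i)))
  have hqP : a = (qP ^ (n + 1)).map MvPolynomial.coeToMvPowerSeries.ringHom := by
    rw [ha, hq, Ideal.map_pow, Ideal.map_span, ← Set.range_comp]
    congr 3
    ext i : 1
    rw [Function.comp_apply, map_sub]
    simp
  apply lead_eq d ((n + d).choose d) (n + 1) (2 * n + 2) e g
  filter_upwards [Filter.eventually_ge_atTop (N₁ + N₂)] with k hk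
  obtain ⟨m₁, hm₁, hm₁'⟩ := h₁ k (by omega)
  obtain ⟨m₂, hm₂, hm₂'⟩ := h₂ (k + (n + 1)) (by omega)
  obtain ⟨m₃, hm₃, hm₃'⟩ := h₁ (k + (2 * n + 2)) (by omega)
  have s1 := (sandwich x n (k + 1)).1
  have s2 := (sandwich x n (k + (n + 1) + 1)).2
  replace hm₁ := hlen _ _ _ hm₁
  replace hm₂ := hlen _ _ _ hm₂
  replace hm₃ := hlen _ _ _ hm₃
  rw [L2 (qP ^ (n + 1)) _ a J hJ hqP] at hm₂
  have t1 : Module.length R (MvPolynomial (Fin d) R ⧸ (Submodule.restrictScalars R _)) ≤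
      Module.length R (MvPolynomial (Fin d) R ⧸ (Submodule.restrictScalars R _)) :=
    length_quot_anti (Submodule.restrictScalars_mono (S := R) s1)
  have t2 : Module.length R (MvPolynomial (Fin d) R ⧸ (Submodule.restrictScalars R _)) ≤
      Module.length R (MvPolynomial (Fin d) R ⧸ (Submodule.restrictScalars R _)) :=
    length_quot_anti (Submodule.restrictScalars_mono (S := R) s2)
  rw [L1, ← hQdef, hm₁, show n + 1 + (k + 1) = k + (n + 1) + 1 by omega] at t1
  rw [L1, ← hQdef, show n + 1 + (k + (n + 1) + 1) = k + (2 * n + 2) + 1 by omega, hm₃] at t2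
  have t1' := t1.trans_eq hm₂
  have t2' := hm₂.symm.trans_le t2
  unfold hilb
  rw [← hm₁', ← hm₂', ← hm₃']
  constructor
  · exact_mod_cast t1'
  · exact_mod_cast t2'

end Stmt10Aux

/-- With `S = R[[y₁,…,y_d]]` and `q = (y₁-x₁,…,y_d-x_d)`:
`e(Q,R) = e((y₁,…,y_d); S/q)` and
`e((y₁,…,y_d); S/q^{n+1}) = binom(n+d,d)·e(Q,R)` for every `n ≥ 0`. -/
theorem stmt10 (R : Type u) [CommRing R] [IsLocalRing R] [IsNoetherianRing R]
    (d : ℕ) (x : Fin d → R) (hx : IsSOP R x)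
    (Q : Ideal R) (hQdef : Q = Ideal.span (Set.range x))
    (e : ℕ → ℤ) (he : HasHilbertSeries R d (fun n => Q ^ n) e)
    (q J : Ideal (MvPowerSeries (Fin d) R))
    (hq : q = Ideal.span (Set.range fun i =>
      (MvPowerSeries.X i : MvPowerSeries (Fin d) R) - MvPowerSeries.C (σ := Fin d) (R := R) (x i)))
    (hJ : J = Ideal.span (Set.range fun i =>
      (MvPowerSeries.X i : MvPowerSeries (Fin d) R))) :
    (∀ f : ℕ → ℤ,
      HasHilbertSeriesMod (MvPowerSeries (Fin d) R) (MvPowerSeries (Fin d) R ⧸ q) d J f →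
        f 0 = e 0) ∧
    (∀ (n : ℕ) (g : ℕ → ℤ),
      HasHilbertSeriesMod (MvPowerSeries (Fin d) R)
          (MvPowerSeries (Fin d) R ⧸ q ^ (n + 1)) d J g →
        g 0 = ((n + d).choose d : ℤ) * e 0) := by
  refine ⟨fun f hf => ?_, fun n g hg => ?_⟩
  · have := Stmt10Aux.main R d x Q hQdef e he q J q hq hJ 0 (by simp) f hf
    simpa using this
  · exact Stmt10Aux.main R d x Q hQdef e he q J _ hq hJ n rfl g hg
end

section
/- Let (R,m) be a Noetherian local ring, let R → (S,n) be an injective module-finite local homomorphism of Noetherian local rings, and let B be a balanced big Cohen–Macaulay R-algebra that is m-adically complete and whose structure map R → B factors through S. Then B is a balanced big Cohen–Macaulay S-algebra, i.e., every system of parameters of S is a regular sequence on B and nB ≠ B. -/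
open IsLocalRing

universe u

section Helpers

open RingTheory.Sequence
open scoped Pointwise

/-- Elementary form of derived completeness along `a`. -/
def DerComplete {S : Type*} [CommRing S] (a : S) (M : Type*) [AddCommGroup M] [Module S M] : Prop :=
  Function.Bijective (fun (u : ℕ → M) (n : ℕ) => u n - a • u (n + 1))

lemma DerComplete.eq_zero {S : Type*} [CommRing S] {a : S} {M : Type*} [AddCommGroup M]
    [Module S M] (h : DerComplete a M) (u : ℕ → M) (hu : ∀ n, u n = a • u (n + 1)) (n : ℕ) :
    u n = 0 := by
  have : u = 0 := h.1 (by
    funext k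
    simp [← hu k])
  simp [this]

lemma DerComplete.congr {S : Type*} [CommRing S] {a : S} {M N : Type*} [AddCommGroup M]
    [Module S M] [AddCommGroup N] [Module S N] (e : M ≃ₗ[S] N) (h : DerComplete a M) :
    DerComplete a N := by
  constructor
  · intro u v huv
    have := @h.1 (fun n => e.symm (u n)) (fun n => e.symm (v n)) (by
      funext n
      have := congrArg e.symm (congrFun huv n)
      simpa using this)
    funext n
    exact e.symm.injective (congrFun this n)
  · intro m
    obtain ⟨u, hu⟩ := h.2 (fun n => e.symm (m n))
    refine ⟨fun n => e (u n), ?_⟩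
    funext n
    have := congrArg e (congrFun hu n)
    simpa using this

lemma DerComplete.quot {S : Type*} [CommRing S] {a : S} {M : Type*} [AddCommGroup M]
    [Module S M] (h : DerComplete a M) (x : S) : DerComplete a (QuotSMulTop x M) := by
  have hs : Function.Surjective (Submodule.mkQ (x • (⊤ : Submodule S M))) :=
    Submodule.mkQ_surjective _
  have key : ∀ v : ℕ → QuotSMulTop x M, (∀ n, v n - a • v (n + 1) = 0) → ∀ n, v n = 0 := by
    intro v hv
    choose w hw using fun n => hs (v n)
    have h1 : ∀ n, ∃ t : M, x • t = w n - a • w (n + 1) := by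
      intro n
      have : Submodule.mkQ (x • (⊤ : Submodule S M)) (w n - a • w (n + 1)) = 0 := by
        rw [map_sub, map_smul, hw, hw]; exact hv n
      rw [Submodule.mkQ_apply, Submodule.Quotient.mk_eq_zero,
        Submodule.mem_smul_pointwise_iff_exists] at this
      obtain ⟨t, -, ht⟩ := this
      exact ⟨t, ht⟩
    choose t ht using h1
    obtain ⟨t', ht'⟩ := h.2 t
    have h2 := h.eq_zero (fun n => w n - x • t' n) (by
      intro n
      have e := ht n
      rw [← congrFun ht' n] at e
      simp only [smul_sub] at e ⊢
      rw [smul_comm a x, ← sub_eq_zero]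
      have e' := sub_eq_zero.mpr e
      rw [← neg_eq_zero, ← e']
      abel)
    intro n
    have h3 := sub_eq_zero.mp (h2 n)
    rw [← hw n, h3, Submodule.mkQ_apply, Submodule.Quotient.mk_eq_zero]
    exact Submodule.smul_mem_pointwise_smul _ _ _ trivial
  constructor
  · intro u v huv
    funext n
    refine sub_eq_zero.mp (key (fun n => u n - v n) (fun n => ?_) n)
    have : (u n - a • u (n + 1)) - (v n - a • v (n + 1)) = 0 :=
      sub_eq_zero.mpr (congrFun huv n)
    rw [← this, smul_sub]
    abel
  · intro m
    choose w hw using fun n => hs (m n)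
    obtain ⟨u, hu⟩ := h.2 w
    refine ⟨fun n => Submodule.mkQ (x • (⊤ : Submodule S M)) (u n), ?_⟩
    funext n
    have := congrFun hu n
    rw [← hw n, ← this, map_sub, map_smul]

lemma DerComplete.quotList {S : Type*} [CommRing S] {a : S} (rs : List S) {M : Type*}
    [AddCommGroup M] [Module S M] (h : DerComplete a M) :
    DerComplete a (M ⧸ (Ideal.ofList rs • ⊤ : Submodule S M)) := by
  induction rs with
  | nil =>
    refine h.congr (Submodule.quotEquivOfEqBot _ ?_).symm
    rw [Ideal.ofList_nil, Submodule.bot_smul]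
  | cons r rs ih =>
    exact (ih.quot r).congr
      (Submodule.quotOfListConsSMulTopEquivQuotSMulTopOuter M r rs).symm

lemma DerComplete.nak {S : Type*} [CommRing S] {a : S} {M : Type*} [AddCommGroup M]
    [Module S M] (h : DerComplete a M) (K : Submodule S M) (hK : K = a • K) : K = ⊥ := by
  rw [eq_bot_iff]
  intro m hm
  have hex : ∀ k : K, ∃ k' : K, (k : M) = a • (k' : M) := by
    rintro ⟨k, hk⟩
    rw [hK, Submodule.mem_smul_pointwise_iff_exists] at hk
    obtain ⟨t, ht, rfl⟩ := hk
    exact ⟨⟨t, ht⟩, rfl⟩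
  choose f hf using hex
  have := h.eq_zero (fun n => ((f^[n] ⟨m, hm⟩ : K) : M)) (fun n => by
    rw [Function.iterate_succ_apply']; exact hf _) 0
  simpa using this

lemma perm_of_derComplete {S : Type*} [CommRing S] {M : Type*} [AddCommGroup M]
    [Module S M] {rs rs' : List S} (hM : ∀ a ∈ rs, DerComplete a M)
    (h : IsWeaklyRegular M rs) (hp : rs.Perm rs') : IsWeaklyRegular M rs' := by
  refine h.prototype_perm hp ?_
  intro a b l hl K hK
  exact ((hM a (hl.subset (by simp))).quotList l).nak K hK

lemma exch {S : Type*} [CommRing S] {M : Type*} [AddCommGroup M]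
    [Module S M] {w xs : List S} {x z : S} (hw : ∀ a ∈ w, ∀ m : M, a • m = 0)
    (h : IsWeaklyRegular M (xs ++ [x])) {j : ℕ} (hx : x ^ j ∈ Ideal.ofList (w ++ (xs ++ [z]))) :
    IsWeaklyRegular M (xs ++ [z]) := by
  rw [isWeaklyRegular_append_iff, isWeaklyRegular_singleton_iff] at h ⊢
  refine ⟨h.1, ?_⟩
  rw [Ideal.ofList_append, Ideal.ofList_append, ← sup_assoc, Ideal.ofList_singleton] at hx
  obtain ⟨p, hp, q, hq, hpq⟩ := Submodule.mem_sup.mp hx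
  obtain ⟨c, rfl⟩ := Ideal.mem_span_singleton'.mp hq
  have hkill : Ideal.ofList w ⊔ Ideal.ofList xs ≤
      Module.annihilator S (M ⧸ (Ideal.ofList xs • ⊤ : Submodule S M)) := by
    refine sup_le ?_ ?_
    · refine Ideal.span_le.mpr fun a ha => ?_
      refine Module.mem_annihilator.mpr fun m => ?_
      obtain ⟨m, rfl⟩ := Submodule.Quotient.mk_surjective _ m
      rw [← Submodule.Quotient.mk_smul, hw a ha m, Submodule.Quotient.mk_zero]
    · intro a ha
      refine Module.mem_annihilator.mpr fun m => ?_
      obtain ⟨m, rfl⟩ := Submodule.Quotient.mk_surjective _ m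
      rw [← Submodule.Quotient.mk_smul, Submodule.Quotient.mk_eq_zero]
      exact Submodule.smul_mem_smul ha trivial
  refine (isSMulRegular_iff_right_eq_zero_of_smul).mpr ?_
  intro m hm
  refine (isSMulRegular_iff_right_eq_zero_of_smul).mp (h.2.pow j) m ?_
  rw [← hpq, add_smul, mul_smul, hm, smul_zero, add_zero]
  exact Module.mem_annihilator.mp (hkill hp) m

lemma exists_param {S : Type*} [CommRing S] [IsLocalRing S] [IsNoetherianRing S] {d : ℕ}
    (hd : (maximalIdeal S).height = d) {s t : List S} (hs : s.length < d) (ht : t.length < d)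
    {x y : S} (hx : (Ideal.ofList (s ++ [x])).radical = maximalIdeal S)
    (hy : (Ideal.ofList (t ++ [y])).radical = maximalIdeal S) :
    ∃ z, (Ideal.ofList (s ++ [z])).radical = maximalIdeal S ∧
      (Ideal.ofList (t ++ [z])).radical = maximalIdeal S := by
  classical
  have hmin : ∀ l : List S, l.length < d →
      maximalIdeal S ∉ (Ideal.ofList l).minimalPrimes := by
    intro l hl hmem
    have : Ideal.ofList l = Ideal.span (l.toFinset : Set S) := by
      simp [Ideal.ofList]
    rw [this] at hmem
    have h1 := Ideal.height_le_card_of_mem_minimalPrimes_span_finset hmem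
    rw [hd] at h1
    have h2 := List.toFinset_card_le l
    have h3 : d ≤ l.toFinset.card := by exact_mod_cast h1
    omega
  have hfin : ((Ideal.ofList s).minimalPrimes ∪ (Ideal.ofList t).minimalPrimes).Finite :=
    (Ideal.finite_minimalPrimes_of_isNoetherianRing S _).union
      (Ideal.finite_minimalPrimes_of_isNoetherianRing S _)
  have hav : ¬ ((maximalIdeal S : Set S) ⊆
      ⋃ i ∈ (Ideal.ofList s).minimalPrimes ∪ (Ideal.ofList t).minimalPrimes, (i : Set S)) := by
    refine (Ideal.subset_union_prime_finite (f := fun i : Ideal S => i) hfin ⊥ ⊥ ?_).not.mpr ?_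
    rotate_left
    · rintro ⟨i, hi, hle⟩
      have hip : i.IsPrime := by rcases hi with hi | hi <;> exact hi.1.1
      have : maximalIdeal S = i :=
        (IsLocalRing.maximalIdeal.isMaximal S).eq_of_le hip.ne_top hle
      subst this
      rcases hi with hi | hi
      · exact hmin s hs hi
      · exact hmin t ht hi
    · intro i hi _ _
      rcases hi with hi | hi <;> exact hi.1.1
  obtain ⟨z, hz, hz'⟩ := Set.not_subset.mp hav
  have gen : ∀ (l : List S) (x : S), (Ideal.ofList (l ++ [x])).radical = maximalIdeal S →
      (∀ i ∈ (Ideal.ofList l).minimalPrimes, z ∉ i) →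
      (Ideal.ofList (l ++ [z])).radical = maximalIdeal S := by
    intro l x hx hzl
    have hins : ∀ y, Ideal.ofList (l ++ [y]) = Ideal.span (insert y {r | r ∈ l}) := by
      intro y
      rw [Ideal.ofList]
      congr 1
      ext r
      simp [or_comm]
    have hle : Ideal.ofList (l ++ [z]) ≤ maximalIdeal S := by
      rw [hins, Ideal.span_le]
      rintro r (rfl | hr)
      · exact hz
      · rw [← hx]
        exact Ideal.le_radical (Ideal.subset_span (by simp at hr; simp [hr]))
    refine le_antisymm ((IsLocalRing.maximalIdeal.isMaximal S).isPrime.radical_le_iff.mpr hle) ?_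
    rw [Ideal.radical_eq_sInf]
    refine le_sInf ?_
    rintro Q ⟨hQ, hQp⟩
    by_contra hnot
    have hlt : Q < maximalIdeal S :=
      lt_of_le_of_ne (IsLocalRing.le_maximalIdeal hQp.ne_top) (fun h => hnot h.ge)
    have hm : maximalIdeal S ∈ (Ideal.span (insert x {r | r ∈ l})).minimalPrimes := by
      rw [← hins]
      refine ⟨⟨(IsLocalRing.maximalIdeal.isMaximal S).isPrime, ?_⟩, ?_⟩
      · rw [← hx]; exact Ideal.le_radical
      · rintro P ⟨hP, hP'⟩ -
        rw [← hx]
        exact hP.radical_le_iff.mpr hP'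
    have := Ideal.mem_minimalPrimes_span_of_mem_minimalPrimes_span_insert hlt x {r | r ∈ l} hm
      {r | r ∈ l} (fun r hr => hQ (Ideal.subset_span (by simp at hr; simp [hr])))
      (fun r hr => Ideal.le_radical (Ideal.subset_span (Set.mem_insert_of_mem _ hr)))
    exact hzl Q this (hQ (Ideal.subset_span (by simp)))
  refine ⟨z, gen s x hx fun i hi hzi => hz' ?_, gen t y hy fun i hi hzi => hz' ?_⟩
  · exact Set.mem_biUnion (Or.inl hi) hzi
  · exact Set.mem_biUnion (Or.inr hi) hzi

lemma key_balanced {S : Type*} [CommRing S] [IsLocalRing S] [IsNoetherianRing S] {d : ℕ}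
    (hd : (maximalIdeal S).height = d) (k : ℕ) : ∀ (w xs ys : List S) (M : Type*)
    [AddCommGroup M] [Module S M], xs.length = k → ys.length = k → w.length + k ≤ d →
    (Ideal.ofList (w ++ xs)).radical = maximalIdeal S →
    (Ideal.ofList (w ++ ys)).radical = maximalIdeal S →
    (∀ a ∈ maximalIdeal S, DerComplete a M) →
    (∀ a ∈ w, ∀ m : M, a • m = 0) →
    IsWeaklyRegular M xs → IsWeaklyRegular M ys := by
  induction k with
  | zero =>
    intro w xs ys M _ _ hxs hys _ _ _ _ _ _
    rw [List.length_eq_zero_iff.mp hys]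
    exact IsWeaklyRegular.nil S M
  | succ k ih =>
    intro w xs ys M _ _ hxs hys hk hrx hry hM hw hreg
    obtain rfl | ⟨xs, x, rfl⟩ := List.eq_nil_or_concat' xs
    · simp at hxs
    obtain rfl | ⟨ys, y, rfl⟩ := List.eq_nil_or_concat' ys
    · simp at hys
    simp only [List.length_append, List.length_singleton, Nat.add_right_cancel_iff] at hxs hys
    obtain ⟨z, hzx, hzy⟩ := exists_param hd (s := w ++ xs) (t := w ++ ys) (x := x) (y := y)
      (by simp; omega) (by simp; omega) (by simpa using hrx) (by simpa using hry)
    rw [List.append_assoc] at hzx hzy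
    have hmem : ∀ l : List S, (Ideal.ofList l).radical = maximalIdeal S →
        ∀ a ∈ l, a ∈ maximalIdeal S := by
      intro l hl a ha
      rw [← hl]
      exact Ideal.le_radical (Ideal.subset_span ha)
    have hx : x ∈ maximalIdeal S := hmem _ hrx x (by simp)
    have hz : z ∈ maximalIdeal S := hmem _ hzx z (by simp)
    obtain ⟨j, hj⟩ := Ideal.mem_radical_iff.mp (hzx ▸ hx)
    obtain ⟨j', hj'⟩ := Ideal.mem_radical_iff.mp (hry ▸ hz)
    have h1 := exch hw hreg hj
    have h2 := perm_of_derComplete (fun a ha => hM a (hmem _ hzx a (by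
      simp only [List.mem_append] at ha ⊢; exact Or.inr ha))) h1
      (List.perm_append_comm (l₁ := xs) (l₂ := [z]))
    rw [List.singleton_append, isWeaklyRegular_cons_iff] at h2
    have hswap : ∀ l : List S, Ideal.ofList ((w ++ [z]) ++ l) = Ideal.ofList (w ++ (l ++ [z])) := by
      intro l
      simp only [Ideal.ofList_append]
      rw [sup_assoc, sup_comm (Ideal.ofList [z])]
    have h3 := ih (w ++ [z]) xs ys (QuotSMulTop z M) hxs hys (by simp; omega)
      (by rw [hswap]; exact hzx) (by rw [hswap]; exact hzy)
      (fun a ha => (hM a ha).quot z) (by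
        intro a ha m
        obtain ⟨m, rfl⟩ := Submodule.Quotient.mk_surjective _ m
        rw [← Submodule.Quotient.mk_smul]
        rcases List.mem_append.mp ha with ha | ha
        · rw [hw a ha m, Submodule.Quotient.mk_zero]
        · rw [List.mem_singleton.mp ha, Submodule.Quotient.mk_eq_zero]
          exact Submodule.smul_mem_pointwise_smul _ _ _ trivial) h2.2
    have h4 : IsWeaklyRegular M ([z] ++ ys) := by
      rw [List.singleton_append, isWeaklyRegular_cons_iff]
      exact ⟨h2.1, h3⟩
    have h5 := perm_of_derComplete (fun a ha => hM a (hmem _ hzy a (by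
      simp only [List.mem_append] at ha ⊢; exact Or.inr ha.symm))) h4
      (List.perm_append_comm (l₁ := [z]) (l₂ := ys))
    exact exch hw h5 hj'

lemma bijective_of_complete {B : Type*} [CommRing B] (J : Ideal B)
    (hH : ∀ x : B, (∀ n, x ∈ J ^ n) → x = 0)
    (hP : ∀ f : ℕ → B, (∀ n, f (n + 1) - f n ∈ J ^ n) → ∃ L, ∀ n, L - f n ∈ J ^ n)
    (b : B) (k : ℕ) (hb : b ^ k ∈ J) :
    Function.Bijective (fun (u : ℕ → B) (n : ℕ) => u n - b * u (n + 1)) := by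
  have hpow : ∀ i j, k * i ≤ j → b ^ j ∈ J ^ i := by
    intro i j hij
    obtain ⟨c, rfl⟩ := Nat.exists_eq_add_of_le hij
    rw [pow_add, pow_mul]
    exact Ideal.mul_mem_right _ _ (Ideal.pow_mem_pow hb i)
  constructor
  · intro u v huv
    have h0 : ∀ n, u n - v n = b * (u (n + 1) - v (n + 1)) := by
      intro n
      have := congrFun huv n
      simp only at this
      linear_combination this
    have h1 : ∀ j n, u n - v n = b ^ j * (u (n + j) - v (n + j)) := by
      intro j
      induction j with
      | zero => intro n; simp
      | succ j ih =>
        intro n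
        rw [ih n, h0 (n + j), pow_succ, mul_assoc]
        rfl
    funext n
    refine sub_eq_zero.mp (hH _ fun i => ?_)
    rw [h1 (k * i) n]
    exact Ideal.mul_mem_right _ _ (hpow i _ le_rfl)
  · intro m
    have hc : ∀ n, ∃ L, ∀ i, L - ∑ j ∈ Finset.range (k * i), b ^ j * m (n + j) ∈ J ^ i := by
      intro n
      refine hP (fun i => ∑ j ∈ Finset.range (k * i), b ^ j * m (n + j)) fun i => ?_
      rw [Nat.mul_succ, Finset.sum_range_add, add_sub_cancel_left]
      refine Ideal.sum_mem _ fun j _ => ?_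
      exact Ideal.mul_mem_right _ _ (hpow i _ (Nat.le_add_right _ _))
    choose u hu using hc
    refine ⟨u, ?_⟩
    funext n
    refine sub_eq_zero.mp (hH _ fun i => ?_)
    have htel : ∀ N, ∑ j ∈ Finset.range N, b ^ j * m (n + j) -
        b * ∑ j ∈ Finset.range N, b ^ j * m (n + 1 + j) = m n - b ^ N * m (n + N) := by
      intro N
      induction N with
      | zero => simp
      | succ N ih =>
        rw [Finset.sum_range_succ, Finset.sum_range_succ]
        rw [show n + 1 + N = n + (N + 1) by ring]
        linear_combination ih
    have e : u n - b * u (n + 1) - m n =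
        (u n - ∑ j ∈ Finset.range (k * i), b ^ j * m (n + j)) -
        b * (u (n + 1) - ∑ j ∈ Finset.range (k * i), b ^ j * m (n + 1 + j)) -
        b ^ (k * i) * m (n + k * i) := by
      linear_combination htel (k * i)
    simp only
    rw [e]
    exact Ideal.sub_mem _ (Ideal.sub_mem _ (hu n i) (Ideal.mul_mem_left _ _ (hu (n + 1) i)))
      (Ideal.mul_mem_right _ _ (hpow i _ le_rfl))

lemma ofList_ofFn {S : Type*} [CommRing S] {d : ℕ} (x : Fin d → S) :
    Ideal.ofList (List.ofFn x) = Ideal.span (Set.range x) := by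
  rw [Ideal.ofList]
  congr 1
  ext r
  simp [List.mem_ofFn]

lemma exists_sop (R : Type*) [CommRing R] [IsLocalRing R] [IsNoetherianRing R] :
    ∃ (d : ℕ) (x : Fin d → R), IsSOP R x := by
  obtain ⟨s, hs, hc⟩ := Ideal.exists_finset_card_eq_height_of_isNoetherianRing (maximalIdeal R)
  refine ⟨s.card, fun i => (s.equivFin.symm i : R), ?_, ?_⟩
  · rw [← IsLocalRing.maximalIdeal_height_eq_ringKrullDim, ← hc]
    rfl
  · have : Set.range (fun i => (s.equivFin.symm i : R)) = (s : Set R) := by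
      ext r
      constructor
      · rintro ⟨i, rfl⟩
        exact (s.equivFin.symm i).2
      · intro hr
        exact ⟨s.equivFin ⟨r, hr⟩, by simp⟩
    rw [this]
    refine le_antisymm (hs.1.1.radical_le_iff.mpr hs.1.2) ?_
    rw [Ideal.radical_eq_sInf]
    refine le_sInf ?_
    rintro Q ⟨hQ, hQp⟩
    exact hs.2 ⟨hQp, hQ⟩ (IsLocalRing.le_maximalIdeal hQp.ne_top)

lemma radical_map {R S : Type*} [CommRing R] [IsLocalRing R]
    [CommRing S] [IsLocalRing S] [Algebra R S] [Algebra.IsIntegral R S]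
    [IsLocalHom (algebraMap R S)] (I : Ideal R) (hI : I.radical = maximalIdeal R) :
    (I.map (algebraMap R S)).radical = maximalIdeal S := by
  have hle : I ≤ maximalIdeal R := hI ▸ Ideal.le_radical
  have hle' : I.map (algebraMap R S) ≤ maximalIdeal S :=
    Ideal.map_le_iff_le_comap.mpr (hle.trans
      (((IsLocalRing.local_hom_TFAE (algebraMap R S)).out 0 3 :
        IsLocalHom (algebraMap R S) ↔ maximalIdeal R ≤ (maximalIdeal S).comap (algebraMap R S)).mp
        ‹_›))
  refine le_antisymm ((IsLocalRing.maximalIdeal.isMaximal S).isPrime.radical_le_iff.mpr hle') ?_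
  rw [Ideal.radical_eq_sInf]
  refine le_sInf ?_
  rintro Q ⟨hQ, hQp⟩
  have h1 : maximalIdeal R ≤ Q.comap (algebraMap R S) := by
    rw [← hI]
    exact (Ideal.IsPrime.comap (algebraMap R S)).radical_le_iff.mpr
      (Ideal.map_le_iff_le_comap.mp hQ)
  have h2 : maximalIdeal R = Q.comap (algebraMap R S) :=
    (IsLocalRing.maximalIdeal.isMaximal R).eq_of_le
      (Ideal.IsPrime.comap (algebraMap R S)).ne_top h1
  have h3 : Q.IsMaximal := Ideal.isMaximal_of_isIntegral_of_isMaximal_comap Q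
    (h2 ▸ IsLocalRing.maximalIdeal.isMaximal R)
  exact (IsLocalRing.eq_maximalIdeal h3).ge

lemma dim_le {R S : Type*} [CommRing R] [IsLocalRing R]
    [CommRing S] [Algebra R S] [Algebra.IsIntegral R S]
    (hinj : Function.Injective (algebraMap R S)) : ringKrullDim R ≤ ringKrullDim S := by
  refine iSup_le fun l => ?_
  obtain ⟨Q, -, hQ, hQl⟩ := Ideal.exists_ideal_over_prime_of_isIntegral (S := S) l.head.asIdeal ⊥
    (by rw [← RingHom.ker_eq_comap_bot, (RingHom.injective_iff_ker_eq_bot _).mp hinj]; exact bot_le)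
  have : Q.LiesOver l.head.asIdeal := ⟨hQl.symm⟩
  obtain ⟨L, hL, _⟩ := Ideal.exists_ltSeries_of_hasGoingUp l Q
  rw [← hL]
  exact le_iSup (fun p : LTSeries (PrimeSpectrum S) => (p.length : WithBot ℕ∞)) L

end Helpers

/-- **Claim in Theorem 3.4.** If `R → S` is an injective module-finite local map of
Noetherian local rings and `B` is an `m`-adically complete balanced big Cohen–Macaulay
`R`-algebra whose structure map factors through `S`, then `B` is a balanced big
Cohen–Macaulay `S`-algebra. -/
theorem stmt13 (R : Type u) [CommRing R] [IsLocalRing R] [IsNoetherianRing R]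
    (S : Type u) [CommRing S] [IsLocalRing S] [IsNoetherianRing S]
    [Algebra R S] (hinj : Function.Injective (algebraMap R S))
    [Module.Finite R S] (hloc : IsLocalHom (algebraMap R S))
    (B : Type u) [CommRing B] [Algebra R B]
    (hB : IsBalancedBigCM R B)
    (hcomp : IsAdicComplete (maximalIdeal R) B)
    (g : S →+* B) (hg : g.comp (algebraMap R S) = algebraMap R B) :
    IsBalancedBigCMHom S g := by
  have hint : Algebra.IsIntegral R S := inferInstance
  letI : Algebra S B := g.toAlgebra
  haveI : IsScalarTower R S B := IsScalarTower.of_algebraMap_eq' hg.symm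
  have hrad : ((maximalIdeal R).map (algebraMap R S)).radical = maximalIdeal S :=
    radical_map _ (IsLocalRing.maximalIdeal.isMaximal R).isPrime.radical
  have hmapmap : ((maximalIdeal R).map (algebraMap R S)).map g =
      (maximalIdeal R).map (algebraMap R B) := by
    rw [Ideal.map_map, hg]
  have hne : (maximalIdeal S).map g ≠ ⊤ := by
    intro htop
    obtain ⟨k, hk⟩ := Ideal.exists_radical_pow_le_of_fg ((maximalIdeal R).map (algebraMap R S))
      (IsNoetherian.noetherian _)
    rw [hrad] at hk
    have h1 := Ideal.map_mono (f := g) hk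
    rw [Ideal.map_pow, htop, Ideal.top_pow, hmapmap] at h1
    exact hB.2 (top_le_iff.mp h1)
  refine ⟨fun d y hy => ?_, hne⟩
  obtain ⟨e, x, hx⟩ := exists_sop R
  -- the image of `x` in `S`
  have hxS : (Ideal.ofList (List.ofFn fun i => algebraMap R S (x i))).radical =
      maximalIdeal S := by
    have := radical_map (S := S) _ hx.2
    rw [ofList_ofFn]
    rw [Ideal.map_span, ← Set.range_comp] at this
    exact this
  have hdS : (maximalIdeal S).height = d := by
    have := IsLocalRing.maximalIdeal_height_eq_ringKrullDim (R := S)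
    rw [hy.1] at this
    exact_mod_cast this
  have hed : e = d := by
    apply le_antisymm
    · have := dim_le (S := S) hinj
      rw [hx.1, hy.1] at this
      exact_mod_cast this
    · by_contra hlt
      push Not at hlt
      have hmem : maximalIdeal S ∈
          (Ideal.span (Set.range fun i => algebraMap R S (x i))).minimalPrimes := by
        rw [ofList_ofFn] at hxS
        refine ⟨⟨(IsLocalRing.maximalIdeal.isMaximal S).isPrime, ?_⟩, ?_⟩
        · rw [← hxS]; exact Ideal.le_radical
        · rintro P ⟨hP, hP'⟩ -
          rw [← hxS]
          exact hP.radical_le_iff.mpr hP'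
      have h1 := Ideal.height_le_card_of_mem_minimalPrimes_span (Set.finite_range _) hmem
      rw [hdS] at h1
      have h2 : d ≤ (Set.range fun i => algebraMap R S (x i)).ncard := by exact_mod_cast h1
      have h3 : (Set.range fun i => algebraMap R S (x i)).ncard ≤ e := by
        rw [← Set.image_univ]
        refine (Set.ncard_image_le Set.finite_univ).trans ?_
        simp [Set.ncard_univ]
      omega
  subst hed
  have hxreg : RingTheory.Sequence.IsWeaklyRegular B
      (List.ofFn fun i => algebraMap R S (x i)) := by
    have h1 := (hB.1 e x hx).toIsWeaklyRegular
    rw [← RingTheory.Sequence.isWeaklyRegular_map_algebraMap_iff B B, List.map_ofFn]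
    convert h1 using 3
    exact RingHom.congr_fun hg (x _)
  have hDC : ∀ a ∈ maximalIdeal S, DerComplete a B := by
    intro a ha
    rw [← hrad] at ha
    obtain ⟨k, hk⟩ := Ideal.mem_radical_iff.mp ha
    have hsm : ∀ n (b : B), b ∈ ((maximalIdeal R) ^ n • ⊤ : Submodule R B) ↔
        b ∈ ((maximalIdeal R).map (algebraMap R B)) ^ n := by
      intro n b
      rw [Ideal.smul_top_eq_map, Ideal.map_pow]
      rfl
    have := bijective_of_complete ((maximalIdeal R).map (algebraMap R B))
      (fun b hb => hcomp.toIsHausdorff.haus' b fun n => by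
        rw [SModEq.zero, hsm]; exact hb n)
      (fun f hf => by
        obtain ⟨L, hL⟩ := hcomp.toIsPrecomplete.prec' f (by
          intro m n hmn
          rw [SModEq.comm, SModEq.sub_mem, hsm]
          induction n, hmn using Nat.le_induction with
          | base => simp
          | succ n hn ih =>
            have := Ideal.add_mem _ (Ideal.pow_le_pow_right hn (hf n)) ih
            simpa using this)
        refine ⟨L, fun n => ?_⟩
        have := (hL n).symm
        rwa [SModEq.sub_mem, hsm] at this)
      (g a) k (by
        rw [← hmapmap, ← map_pow]
        exact Ideal.mem_map_of_mem g hk)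
    exact this
  have hyS : (Ideal.ofList (List.ofFn y)).radical = maximalIdeal S := by
    rw [ofList_ofFn]; exact hy.2
  have hyreg := key_balanced hdS e [] _ (List.ofFn y) B
    List.length_ofFn List.length_ofFn (by simp)
    hxS hyS hDC (by simp) hxreg
  refine ⟨?_, ?_⟩
  · rw [← RingTheory.Sequence.isWeaklyRegular_map_algebraMap_iff B B, List.map_ofFn] at hyreg
    exact hyreg
  · intro htop
    rw [smul_eq_mul, Ideal.mul_top] at htop
    refine hne (top_le_iff.mp (htop.le.trans ?_))
    refine Ideal.span_le.mpr ?_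
    intro b hb
    obtain ⟨i, rfl⟩ := (List.mem_ofFn' _ _).mp hb
    refine Ideal.mem_map_of_mem g ?_
    rw [← hy.2]
    exact Ideal.le_radical (Ideal.subset_span ⟨i, rfl⟩)
end
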